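/- Fix b > 0 and η ∈ [0,1) satisfying b²(1−η) < W(2/e). Let m : ℕ → ℕ be any sequence with m(n)/n^{3/2} → b/2 as n → ∞. Then lim_{n→∞} n^{-3/2}·log P_{m(n)}( X ≤ η·E X ) = −(b³/6)·(1 − η + η·log η), where η·log η is interpreted as 0 when η = 0, and E X denotes the expected number of triangles of G(n, m(n)). -/

import Mathlib

open Filter
open scoped BigOperators symmDiff Classical

noncomputable section

/-- Number of edges of a labeled simple graph on `Fin n`. -/
def edgeCount {n : ℕ} (G : SimpleGraph (Fin n)) : ℕ := Nat.card G.edgeSet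

/-- Number of triangles of a labeled simple graph on `Fin n`. -/
def triCount {n : ℕ} (G : SimpleGraph (Fin n)) : ℕ :=
  Nat.card {s : Finset (Fin n) // G.IsNClique 3 s}

/-- Probability of the event `A` under the Erdős–Rényi random graph `G(n,p)`. -/
def erProb (n : ℕ) (p : ℝ) (A : Set (SimpleGraph (Fin n))) : ℝ :=
  ∑ G : SimpleGraph (Fin n),
    if G ∈ A then p ^ edgeCount G * (1 - p) ^ (n.choose 2 - edgeCount G) else 0

/-- Conditional probability `P_p(A | B)` for `G(n,p)`. -/
def erCondProb (n : ℕ) (p : ℝ) (A B : Set (SimpleGraph (Fin n))) : ℝ :=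
  erProb n p (A ∩ B) / erProb n p B

/-- Probability of the event `A` under the uniform random graph `G(n,m)`. -/
def gnmProb (n m : ℕ) (A : Set (SimpleGraph (Fin n))) : ℝ :=
  (Nat.card {G : SimpleGraph (Fin n) // edgeCount G = m ∧ G ∈ A} : ℝ) /
    ((n.choose 2).choose m : ℝ)

/-- Expected number of triangles of `G(n,m)`. -/
def gnmExpTri (n m : ℕ) : ℝ :=
  (∑ G : SimpleGraph (Fin n), if edgeCount G = m then (triCount G : ℝ) else 0) /
    ((n.choose 2).choose m : ℝ)

/-- Gibbs weight `λ^{|G|} (1-ζ)^{X(G)}`. -/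
def gibbsWeight {n : ℕ} (lam zeta : ℝ) (G : SimpleGraph (Fin n)) : ℝ :=
  lam ^ edgeCount G * (1 - zeta) ^ triCount G

/-- The partition function `Z(λ,ζ)`. -/
def Zfun (n : ℕ) (lam zeta : ℝ) : ℝ := ∑ G : SimpleGraph (Fin n), gibbsWeight lam zeta G

/-- Probability of the event `A` under the Gibbs measure `μ_{λ,ζ}`. -/
def gibbsProb (n : ℕ) (lam zeta : ℝ) (A : Set (SimpleGraph (Fin n))) : ℝ :=
  (∑ G : SimpleGraph (Fin n), if G ∈ A then gibbsWeight lam zeta G else 0) / Zfun n lam zeta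

/-- Expectation of `f` under the Gibbs measure `μ_{λ,ζ}`. -/
def gibbsExp (n : ℕ) (lam zeta : ℝ) (f : SimpleGraph (Fin n) → ℝ) : ℝ :=
  (∑ G : SimpleGraph (Fin n), f G * gibbsWeight lam zeta G) / Zfun n lam zeta

/-- Number of edges of `H` with both endpoints in `S`. -/
def edgesIn {V : Type*} (H : SimpleGraph V) (S : Finset V) : ℕ :=
  Nat.card {e : Sym2 V // e ∈ H.edgeSet ∧ ∀ v ∈ e, v ∈ S}

/-- Weight `λ^{|S|} (1-ζ)^{|E(S)|}` of the measure `ν_{H,λ,ζ}`. -/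
def nuWeight {V : Type*} (H : SimpleGraph V) (lam zeta : ℝ) (S : Finset V) : ℝ :=
  lam ^ S.card * (1 - zeta) ^ edgesIn H S

/-- The partition function `Ξ_H(λ,ζ)`. -/
def XiFun {V : Type*} [Fintype V] (H : SimpleGraph V) (lam zeta : ℝ) : ℝ :=
  ∑ S : Finset V, nuWeight H lam zeta S

/-- The probability of `S` under `ν_{H,λ,ζ}`. -/
def nuProb {V : Type*} [Fintype V] (H : SimpleGraph V) (lam zeta : ℝ) (S : Finset V) : ℝ :=
  nuWeight H lam zeta S / XiFun H lam zeta

/-- `W` is the Lambert-W function on `[0,∞)`: for `x ≥ 0`, `W x` is the unique `w ≥ 0`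
with `w·e^w = x`. -/
def IsLambertW (W : ℝ → ℝ) : Prop :=
  ∀ x : ℝ, 0 ≤ x → (0 ≤ W x ∧ W x * Real.exp (W x) = x ∧
    ∀ w : ℝ, 0 ≤ w → w * Real.exp w = x → w = W x)

/-- `η* = (W(2/e)/(2/e))^{3/2}`. -/
def etaStar (W : ℝ → ℝ) : ℝ := (W (2 / Real.exp 1) / (2 / Real.exp 1)) ^ ((3 : ℝ) / 2)

/-- The condition `c < c̄(η)` where `c̄(η) = 1/√(e(1−η/η*))` for `η < η*` and `+∞` otherwise. -/
def LtCbar (W : ℝ → ℝ) (c η : ℝ) : Prop :=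
  η < etaStar W → c < 1 / Real.sqrt (Real.exp 1 * (1 - η / etaStar W))

/-- The left-hand side of the equation defining `ζ(c,η)`, interpreted as `1` at `ζ = 0`. -/
def zetaLHS (W : ℝ → ℝ) (c zeta : ℝ) : ℝ :=
  (1 - zeta) * (if zeta = 0 then 1 else
    (W (2 * zeta * c ^ 2) / (2 * zeta * c ^ 2)) ^ ((3 : ℝ) / 2))

/-- The non-diagonal pairs of vertices that are not contained in `A`. -/
def outerPairs {V : Type*} [Fintype V] (A : Finset V) : Finset (Sym2 V) :=
  Finset.univ.filter fun e => ¬ e.IsDiag ∧ ¬ ∀ v ∈ e, v ∈ A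

/-- The number of triangles spanned by a set of pairs. -/
def triIn {V : Type*} [Fintype V] (S : Finset (Sym2 V)) : ℕ :=
  ((Finset.powersetCard 3 (Finset.univ : Finset V)).filter fun T =>
    ∀ x ∈ T, ∀ y ∈ T, x ≠ y → s(x, y) ∈ S).card

/-- The vertices joined in `S` to both ends of `p`. -/
def linkIn {V : Type*} [Fintype V] (p : Sym2 V) (S : Finset (Sym2 V)) : Finset V :=
  Finset.univ.filter fun x => ∀ v ∈ p, s(v, x) ∈ S

/-- The number of cherries in `S` with centre `x` and ends a pair from `K x`. -/
def cherryIn {V : Type*} [Fintype V] (K : V → Finset (Sym2 V)) (S : Finset (Sym2 V)) : ℕ :=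
  ∑ x, ((K x).filter fun p => x ∈ linkIn p S).card

/-- Add the pair `p` to the cherry constraints centred in `X`. -/
def addPair {V : Type*} (p : Sym2 V) (X : Finset V) (K : V → Finset (Sym2 V)) :
    V → Finset (Sym2 V) :=
  fun x => if x ∈ X then insert p (K x) else K x

/-- The partition function of graphs without edges inside `A`, where triangles and the cherries
prescribed by `K` are penalised by a factor `1 - ζ`. -/
def cherryZ {V : Type*} [Fintype V] (lam ζ : ℝ) (A : Finset V) (K : V → Finset (Sym2 V)) : ℝ :=
  ∑ S ∈ (outerPairs A).powerset, lam ^ S.card * (1 - ζ) ^ (triIn S + cherryIn K S)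

section Combinatorics

variable {V : Type*} [Fintype V]

lemma mem_outerPairs {A : Finset V} {x y : V} :
    s(x, y) ∈ outerPairs A ↔ x ≠ y ∧ ¬ (x ∈ A ∧ y ∈ A) := by
  simp only [outerPairs, Finset.mem_filter, Finset.mem_univ, true_and, Sym2.mk_isDiag_iff,
    Sym2.mem_iff, forall_eq_or_imp, forall_eq]

lemma mem_linkIn {a b x : V} {S : Finset (Sym2 V)} :
    x ∈ linkIn s(a, b) S ↔ s(a, x) ∈ S ∧ s(b, x) ∈ S := by
  simp [linkIn]

lemma linkIn_mono (p : Sym2 V) {S T : Finset (Sym2 V)} (h : S ⊆ T) :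
    linkIn p S ⊆ linkIn p T := by
  intro x
  simp only [linkIn, Finset.mem_filter, Finset.mem_univ, true_and]
  exact fun hx v hv => h (hx v hv)

lemma triIn_mono {S T : Finset (Sym2 V)} (h : S ⊆ T) : triIn S ≤ triIn T := by
  unfold triIn
  apply Finset.card_le_card
  intro X
  simp only [Finset.mem_filter]
  exact fun hX => ⟨hX.1, fun x hx y hy hxy => h (hX.2 x hx y hy hxy)⟩

lemma cherryIn_mono (K : V → Finset (Sym2 V)) {S T : Finset (Sym2 V)} (h : S ⊆ T) :
    cherryIn K S ≤ cherryIn K T := by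
  unfold cherryIn
  refine Finset.sum_le_sum fun x _ => Finset.card_le_card ?_
  intro p
  simp only [Finset.mem_filter]
  exact fun hp => ⟨hp.1, linkIn_mono p h hp.2⟩

/-- Adding an edge creates one triangle for each common neighbour of its ends. -/
lemma triIn_insert {u v : V} (huv : u ≠ v) {S : Finset (Sym2 V)} (hS : ∀ e ∈ S, ¬ e.IsDiag)
    (h : s(u, v) ∉ S) : triIn (insert s(u, v) S) = triIn S + (linkIn s(u, v) S).card := by
  have hne : ∀ x ∈ linkIn s(u, v) S, x ≠ u ∧ x ≠ v := by
    intro x hx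
    rw [mem_linkIn] at hx
    refine ⟨?_, ?_⟩
    · rintro rfl
      exact hS _ hx.1 (by simp)
    · rintro rfl
      exact hS _ hx.2 (by simp)
  have hinj : Set.InjOn (fun x => ({u, v, x} : Finset V)) (linkIn s(u, v) S) := by
    intro x hx y hy hxy
    have hx' := hne x hx
    have : x ∈ ({u, v, y} : Finset V) := by
      have h2 : ({u, v, x} : Finset V) = {u, v, y} := hxy
      rw [← h2]; simp
    simp only [Finset.mem_insert, Finset.mem_singleton] at this
    rcases this with h | h | h
    · exact absurd h hx'.1
    · exact absurd h hx'.2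
    · exact h
  rw [← Finset.card_image_of_injOn hinj]
  unfold triIn
  rw [← Finset.card_union_of_disjoint]
  · congr 1
    ext T
    simp only [Finset.mem_union, Finset.mem_filter, Finset.mem_image, Finset.mem_powersetCard,
      Finset.subset_univ, true_and]
    constructor
    · rintro ⟨hT, hT2⟩
      by_cases hc : u ∈ T ∧ v ∈ T
      · right
        have h2 : ({u, v} : Finset V) ⊆ T := by
          intro y hy
          simp only [Finset.mem_insert, Finset.mem_singleton] at hy
          rcases hy with rfl | rfl
          exacts [hc.1, hc.2]
        have h3 : (T \ {u, v}).card = 1 := by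
          rw [Finset.card_sdiff_of_subset h2, hT, Finset.card_pair huv]
        obtain ⟨x, hx⟩ := Finset.card_eq_one.1 h3
        have hxT : x ∈ T \ {u, v} := by rw [hx]; simp
        simp only [Finset.mem_sdiff, Finset.mem_insert, Finset.mem_singleton, not_or] at hxT
        refine ⟨x, ?_, ?_⟩
        · rw [mem_linkIn]
          have h4 := hT2 u hc.1 x hxT.1 (Ne.symm hxT.2.1)
          have h5 := hT2 v hc.2 x hxT.1 (Ne.symm hxT.2.2)
          rw [Finset.mem_insert] at h4 h5
          refine ⟨h4.resolve_left ?_, h5.resolve_left ?_⟩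
          · intro h6
            rcases Sym2.eq_iff.1 h6 with h6 | h6
            · exact hxT.2.2 h6.2
            · exact huv h6.1
          · intro h6
            rcases Sym2.eq_iff.1 h6 with h6 | h6
            · exact huv h6.1.symm
            · exact hxT.2.1 h6.2
        · have := Finset.sdiff_union_of_subset h2
          rw [hx] at this
          rw [← this]
          ext y
          simp only [Finset.mem_union, Finset.mem_insert, Finset.mem_singleton]
          tauto
      · left
        refine ⟨hT, fun x hx y hy hxy => ?_⟩
        have h4 := hT2 x hx y hy hxy
        rw [Finset.mem_insert] at h4
        refine h4.resolve_left fun h6 => hc ?_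
        rcases Sym2.eq_iff.1 h6 with ⟨rfl, rfl⟩ | ⟨rfl, rfl⟩
        exacts [⟨hx, hy⟩, ⟨hy, hx⟩]
    · rintro (⟨hT, hT2⟩ | ⟨x, hx, rfl⟩)
      · exact ⟨hT, fun x hx y hy hxy => Finset.mem_insert_of_mem (hT2 x hx y hy hxy)⟩
      · have hx' := hne x hx
        rw [mem_linkIn] at hx
        refine ⟨?_, ?_⟩
        · rw [Finset.card_eq_three]
          exact ⟨u, v, x, huv, hx'.1.symm, hx'.2.symm, rfl⟩
        · have h1 : s(x, u) ∈ S := by rw [Sym2.eq_swap]; exact hx.1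
          have h2 : s(x, v) ∈ S := by rw [Sym2.eq_swap]; exact hx.2
          have h3 : s(v, u) = s(u, v) := Sym2.eq_swap
          intro y hy w hw hyw
          simp only [Finset.mem_insert, Finset.mem_singleton] at hy hw ⊢
          rcases hy with rfl | rfl | rfl <;> rcases hw with rfl | rfl | rfl <;>
            simp_all
  · rw [Finset.disjoint_left]
    intro T hT hT2
    simp only [Finset.mem_filter, Finset.mem_image] at hT hT2
    obtain ⟨x, hx, rfl⟩ := hT2
    exact h (hT.2 u (by simp) v (by simp) huv)

lemma cherryIn_addPair {p : Sym2 V} {X : Finset V} {K : V → Finset (Sym2 V)}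
    (h : ∀ x ∈ X, p ∉ K x) (S : Finset (Sym2 V)) :
    cherryIn (addPair p X K) S = cherryIn K S + (X.filter fun x => x ∈ linkIn p S).card := by
  unfold cherryIn
  have : (X.filter fun x => x ∈ linkIn p S).card
      = ∑ x, if x ∈ X ∧ x ∈ linkIn p S then 1 else 0 := by
    rw [Finset.card_eq_sum_ones, Finset.sum_filter, ← Finset.sum_filter, Finset.sum_boole,
      Finset.card_eq_sum_ones]
    simp only [Finset.filter_and, Finset.filter_mem_eq_inter, Finset.univ_inter]
    simp
  rw [this, ← Finset.sum_add_distrib]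
  refine Finset.sum_congr rfl fun x _ => ?_
  unfold addPair
  by_cases hx : x ∈ X
  · by_cases hl : x ∈ linkIn p S
    · simp only [hx, if_true, hl, and_self, Finset.filter_insert]
      rw [Finset.card_insert_of_notMem]
      simp [h x hx]
    · simp [hx, hl, Finset.filter_insert]
  · simp [hx]

/-- Adding two edges at a vertex `z` to a graph without edges inside `insert z A` amounts to adding
the corresponding cherry constraints. -/
lemma exponent_insert_insert {A : Finset V} {K : V → Finset (Sym2 V)}
    (hK : ∀ x, ∀ p ∈ K x, ¬ p.IsDiag ∧ ∀ v ∈ p, v ∈ A) {a b z : V} (ha : a ∈ A) (hb : b ∈ A)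
    (hab : a ≠ b) (hz : z ∉ A) (hp : s(a, b) ∉ K z) {S : Finset (Sym2 V)}
    (hS : S ⊆ outerPairs (insert z A)) :
    triIn (insert s(a, z) (insert s(b, z) S)) + cherryIn K (insert s(a, z) (insert s(b, z) S)) =
      triIn S + cherryIn (addPair s(b, z) (insert z A)ᶜ (addPair s(a, z) (insert z A)ᶜ K)) S := by
  have haz : a ≠ z := fun h => hz (h ▸ ha)
  have hbz : b ≠ z := fun h => hz (h ▸ hb)
  have hin : ∀ x y, x ∈ insert z A → y ∈ insert z A → s(x, y) ∉ S := by
    intro x y hx hy hxy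
    exact (mem_outerPairs.1 (hS hxy)).2 ⟨hx, hy⟩
  have hzm : z ∈ insert z A := Finset.mem_insert_self _ _
  have ham : a ∈ insert z A := Finset.mem_insert_of_mem ha
  have hbm : b ∈ insert z A := Finset.mem_insert_of_mem hb
  have hdiag : ∀ e ∈ S, ¬ e.IsDiag := by
    intro e he
    have := hS he
    simp only [outerPairs, Finset.mem_filter] at this
    exact this.2.1
  have hne : s(a, z) ≠ s(b, z) := by
    intro h
    rcases Sym2.eq_iff.1 h with h | h
    · exact hab h.1
    · exact haz h.1
  rw [triIn_insert haz, triIn_insert hbz hdiag (hin _ _ hbm hzm)]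
  rotate_left
  · intro e he
    rcases Finset.mem_insert.1 he with rfl | he
    · simpa using hbz
    · exact hdiag e he
  · rw [Finset.mem_insert, not_or]
    exact ⟨hne, hin _ _ ham hzm⟩
  have hl : linkIn s(a, z) (insert s(b, z) S) = linkIn s(a, z) S := by
    refine (Finset.Subset.antisymm ?_ (linkIn_mono _ (Finset.subset_insert _ _)))
    intro x hx
    rw [mem_linkIn] at hx ⊢
    simp only [Finset.mem_insert] at hx
    obtain ⟨h1, h2⟩ := hx
    have h1' : s(a, x) ∈ S := by
      refine h1.resolve_left fun h => ?_
      rcases Sym2.eq_iff.1 h with h | h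
      · exact hab h.1
      · exact haz h.1
    refine ⟨h1', h2.resolve_left fun h => ?_⟩
    rcases Sym2.eq_iff.1 h with h | h
    · exact hbz h.1.symm
    · rw [h.2] at h1'
      exact hin _ _ ham hbm h1'
  have hlc : ∀ c ∈ A, ((insert z A)ᶜ.filter fun x => x ∈ linkIn s(c, z) S) = linkIn s(c, z) S := by
    intro c hc
    rw [Finset.filter_mem_eq_inter, Finset.inter_eq_right]
    intro x hx
    rw [mem_linkIn] at hx
    rw [Finset.mem_compl]
    exact fun h => hin _ _ hzm h hx.2
  have hnK : ∀ c x, s(c, z) ∉ K x := fun c x h => hz ((hK x _ h).2 z (by simp))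
  rw [cherryIn_addPair, cherryIn_addPair, hlc a ha, hlc b hb, hl]
  rotate_left
  · intro x _
    exact hnK a x
  · intro x hx
    rw [addPair, if_pos hx, Finset.mem_insert, not_or]
    exact ⟨hne.symm, hnK b x⟩
  have hc : cherryIn K (insert s(a, z) (insert s(b, z) S)) = cherryIn K S := by
    unfold cherryIn
    refine Finset.sum_congr rfl fun x _ => ?_
    congr 1
    refine Finset.filter_congr fun p hpK => ?_
    constructor
    · obtain ⟨hd, hA⟩ := hK x p hpK
      induction p with
      | _ α β =>
        simp only [Sym2.mem_iff, forall_eq_or_imp, forall_eq] at hA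
        simp only [Sym2.mk_isDiag_iff] at hd
        have hαz : α ≠ z := fun h => hz (h ▸ hA.1)
        have hβz : β ≠ z := fun h => hz (h ▸ hA.2)
        rw [mem_linkIn, mem_linkIn]
        simp only [Finset.mem_insert, Sym2.eq_iff]
        rintro ⟨h1, h2⟩
        by_cases hxz : x = z
        · subst hxz
          exfalso
          have h3 := hin α x (Finset.mem_insert_of_mem hA.1) hzm
          have h4 := hin β x (Finset.mem_insert_of_mem hA.2) hzm
          have h5 : α = a ∨ α = b := by tauto
          have h6 : β = a ∨ β = b := by tauto
          rcases h5 with rfl | rfl <;> rcases h6 with rfl | rfl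
          · exact hd rfl
          · exact hp hpK
          · exact hp (by rw [Sym2.eq_swap]; exact hpK)
          · exact hd rfl
        · tauto
    · exact fun h => linkIn_mono p ((Finset.subset_insert _ _).trans (Finset.subset_insert _ _)) h
  rw [hc]
  ring

end Combinatorics

lemma sum_powerset_union {α : Type*} [DecidableEq α] {s t : Finset α} (h : Disjoint s t)
    (f : Finset α → ℝ) :
    ∑ S ∈ (s ∪ t).powerset, f S = ∑ R ∈ t.powerset, ∑ S ∈ s.powerset, f (S ∪ R) := by
  induction t using Finset.induction_on generalizing f with
  | empty => simp
  | insert a t ha ih =>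
    rw [Finset.disjoint_insert_right] at h
    have hat : a ∉ s ∪ t := by simp [h.1, ha]
    rw [Finset.union_insert, Finset.sum_powerset_insert hat, Finset.sum_powerset_insert ha,
      ih h.2, ih h.2 fun S => f (insert a S)]
    simp only [Finset.union_insert]

lemma sum_powerset_pow_card {α : Type*} (s : Finset α) (x : ℝ) :
    ∑ S ∈ s.powerset, x ^ S.card = (1 + x) ^ s.card := by
  have := Finset.prod_one_add (f := fun _ : α => x) s
  simp only [Finset.prod_const] at this
  exact this.symm

lemma card_image_pair {V : Type*} {A : Finset V} {z : V} :
    (A.image fun a => s(a, z)).card = A.card := by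
  apply Finset.card_image_of_injective
  intro a b h
  rcases Sym2.eq_iff.1 h with h | h
  · exact h.1
  · exact h.1.trans h.2

lemma addPair_valid {V : Type*} {A X : Finset V} {K : V → Finset (Sym2 V)}
    (hK : ∀ x, ∀ p ∈ K x, ¬ p.IsDiag ∧ ∀ v ∈ p, v ∈ A) {a b : V} (ha : a ∈ A) (hb : b ∈ A)
    (hab : a ≠ b) : ∀ x, ∀ p ∈ addPair s(a, b) X K x, ¬ p.IsDiag ∧ ∀ v ∈ p, v ∈ A := by
  intro x p hp
  unfold addPair at hp
  split_ifs at hp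
  · rcases Finset.mem_insert.1 hp with rfl | hp
    · simp [hab, ha, hb]
    · exact hK x p hp
  · exact hK x p hp

section Recursion

variable {V : Type*} [Fintype V] {lam ζ : ℝ}

lemma outerPairs_eq_union {A : Finset V} {z : V} (hz : z ∉ A) :
    outerPairs A = outerPairs (insert z A) ∪ A.image fun a => s(a, z) := by
  ext e
  induction e with
  | _ x y =>
    simp only [Finset.mem_union, mem_outerPairs, Finset.mem_image, Finset.mem_insert, Sym2.eq_iff]
    constructor
    · rintro ⟨hxy, h⟩
      by_cases hx : x = z ∨ x ∈ A
      · by_cases hy : y = z ∨ y ∈ A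
        · right
          rcases hx with rfl | hx <;> rcases hy with rfl | hy
          · exact absurd rfl hxy
          · exact ⟨y, hy, Or.inr ⟨rfl, rfl⟩⟩
          · exact ⟨x, hx, Or.inl ⟨rfl, rfl⟩⟩
          · exact absurd ⟨hx, hy⟩ h
        · left; tauto
      · left; tauto
    · rintro (⟨hxy, h⟩ | ⟨a, ha, ⟨rfl, rfl⟩ | ⟨rfl, rfl⟩⟩)
      · exact ⟨hxy, by tauto⟩
      · exact ⟨fun h => hz (h ▸ ha), fun h => hz h.2⟩
      · exact ⟨fun h => hz (h ▸ ha), fun h => hz h.1⟩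

lemma disjoint_outerPairs {A : Finset V} {z : V} :
    Disjoint (outerPairs (insert z A)) (A.image fun a => s(a, z)) := by
  rw [Finset.disjoint_left]
  intro e he he2
  obtain ⟨a, ha, rfl⟩ := Finset.mem_image.1 he2
  rw [mem_outerPairs] at he
  exact he.2 ⟨Finset.mem_insert_of_mem ha, Finset.mem_insert_self _ _⟩

lemma cherryZ_nonneg (h0 : 0 ≤ lam) (hζ1 : ζ ≤ 1) (A : Finset V) (K : V → Finset (Sym2 V)) :
    0 ≤ cherryZ lam ζ A K :=
  Finset.sum_nonneg fun _ _ => mul_nonneg (pow_nonneg h0 _) (pow_nonneg (by linarith) _)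

lemma cherryZ_split (A : Finset V) (K : V → Finset (Sym2 V)) {z : V} (hz : z ∉ A) :
    cherryZ lam ζ A K = ∑ R ∈ (A.image fun a => s(a, z)).powerset,
      ∑ S ∈ (outerPairs (insert z A)).powerset,
        lam ^ (S ∪ R).card * (1 - ζ) ^ (triIn (S ∪ R) + cherryIn K (S ∪ R)) := by
  unfold cherryZ
  rw [outerPairs_eq_union hz, sum_powerset_union disjoint_outerPairs]

lemma cherryZ_part_le (h0 : 0 ≤ lam) (hζ0 : 0 ≤ ζ) (hζ1 : ζ ≤ 1) {A : Finset V}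
    (K : V → Finset (Sym2 V)) {z : V} {R : Finset (Sym2 V)}
    (hR : R ⊆ A.image fun a => s(a, z)) :
    ∑ S ∈ (outerPairs (insert z A)).powerset,
        lam ^ (S ∪ R).card * (1 - ζ) ^ (triIn (S ∪ R) + cherryIn K (S ∪ R))
      ≤ lam ^ R.card * cherryZ lam ζ (insert z A) K := by
  unfold cherryZ
  rw [Finset.mul_sum]
  refine Finset.sum_le_sum fun S hS => ?_
  have hd : Disjoint S R :=
    Finset.disjoint_of_subset_left (Finset.mem_powerset.1 hS)
      (Finset.disjoint_of_subset_right hR disjoint_outerPairs)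
  rw [Finset.card_union_of_disjoint hd, pow_add, mul_comm (lam ^ S.card), mul_assoc]
  have h1 : (1 - ζ) ^ (triIn (S ∪ R) + cherryIn K (S ∪ R))
      ≤ (1 - ζ) ^ (triIn S + cherryIn K S) :=
    pow_le_pow_of_le_one (by linarith) (by linarith)
      (add_le_add (triIn_mono Finset.subset_union_left)
        (cherryIn_mono K Finset.subset_union_left))
  gcongr

lemma cherryZ_insert_le (h0 : 0 ≤ lam) (hζ1 : ζ ≤ 1) {A : Finset V}
    (K : V → Finset (Sym2 V)) {z : V} (hz : z ∉ A) :
    cherryZ lam ζ (insert z A) K ≤ cherryZ lam ζ A K := by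
  unfold cherryZ
  refine Finset.sum_le_sum_of_subset_of_nonneg (Finset.powerset_mono.2 ?_) fun S _ _ =>
    mul_nonneg (pow_nonneg h0 _) (pow_nonneg (by linarith) _)
  rw [outerPairs_eq_union hz]
  exact Finset.subset_union_left

lemma cherryZ_le_insert (h0 : 0 ≤ lam) (hζ0 : 0 ≤ ζ) (hζ1 : ζ ≤ 1) {A : Finset V}
    (K : V → Finset (Sym2 V)) {z : V} (hz : z ∉ A) :
    cherryZ lam ζ A K ≤ (1 + lam) ^ A.card * cherryZ lam ζ (insert z A) K := by
  rw [cherryZ_split A K hz]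
  refine (Finset.sum_le_sum fun R hR => cherryZ_part_le h0 hζ0 hζ1 K
    (Finset.mem_powerset.1 hR)).trans ?_
  rw [← Finset.sum_mul, sum_powerset_pow_card, card_image_pair]

/-- The part of the partition function `cherryZ` carried by the graphs that contain the cherry with
centre `z` and ends `a`, `b`. -/
def cherryPart (lam ζ : ℝ) (A : Finset V) (K : V → Finset (Sym2 V)) (a b z : V) : ℝ :=
  ∑ S ∈ (outerPairs A).powerset,
    if z ∈ linkIn s(a, b) S then lam ^ S.card * (1 - ζ) ^ (triIn S + cherryIn K S) else 0

lemma cherryZ_addPair_singleton {A : Finset V} {K : V → Finset (Sym2 V)} {a b z : V}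
    (hp : s(a, b) ∉ K z) :
    cherryZ lam ζ A (addPair s(a, b) {z} K)
      = cherryZ lam ζ A K - ζ * cherryPart lam ζ A K a b z := by
  unfold cherryZ cherryPart
  rw [Finset.mul_sum, ← Finset.sum_sub_distrib]
  refine Finset.sum_congr rfl fun S _ => ?_
  rw [cherryIn_addPair (by simpa using hp), Finset.filter_singleton]
  split_ifs
  · rw [Finset.card_singleton, ← add_assoc, pow_succ]
    ring
  · simp

lemma cherryPart_eq {A : Finset V} {K : V → Finset (Sym2 V)} {a b z : V} (ha : a ∈ A) (hb : b ∈ A)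
    (hz : z ∉ A) :
    cherryPart lam ζ A K a b z = ∑ R ∈ (A.image fun a => s(a, z)).powerset.filter
        (fun R => {s(a, z), s(b, z)} ⊆ R),
      ∑ S ∈ (outerPairs (insert z A)).powerset,
        lam ^ (S ∪ R).card * (1 - ζ) ^ (triIn (S ∪ R) + cherryIn K (S ∪ R)) := by
  unfold cherryPart
  rw [outerPairs_eq_union hz, sum_powerset_union disjoint_outerPairs, Finset.sum_filter]
  refine Finset.sum_congr rfl fun R _ => ?_
  have h1 : ∀ S ∈ (outerPairs (insert z A)).powerset,
      (z ∈ linkIn s(a, b) (S ∪ R) ↔ {s(a, z), s(b, z)} ⊆ R) := by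
    intro S hS
    have h2 : ∀ c ∈ A, s(c, z) ∉ S := by
      intro c hc h
      have := mem_outerPairs.1 (Finset.mem_powerset.1 hS h)
      exact this.2 ⟨Finset.mem_insert_of_mem hc, Finset.mem_insert_self _ _⟩
    rw [mem_linkIn, Finset.mem_union, Finset.mem_union, Finset.insert_subset_iff,
      Finset.singleton_subset_iff]
    have := h2 a ha
    have := h2 b hb
    tauto
  by_cases hR : {s(a, z), s(b, z)} ⊆ R
  · rw [if_pos hR]
    exact Finset.sum_congr rfl fun S hS => if_pos ((h1 S hS).2 hR)
  · rw [if_neg hR]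
    exact Finset.sum_eq_zero fun S hS => if_neg (fun h => hR ((h1 S hS).1 h))

lemma cherryPart_main {A : Finset V} {K : V → Finset (Sym2 V)}
    (hK : ∀ x, ∀ p ∈ K x, ¬ p.IsDiag ∧ ∀ v ∈ p, v ∈ A) {a b z : V} (ha : a ∈ A) (hb : b ∈ A)
    (hab : a ≠ b) (hz : z ∉ A) (hp : s(a, b) ∉ K z) :
    ∑ S ∈ (outerPairs (insert z A)).powerset, lam ^ (S ∪ {s(a, z), s(b, z)}).card *
        (1 - ζ) ^ (triIn (S ∪ {s(a, z), s(b, z)}) + cherryIn K (S ∪ {s(a, z), s(b, z)})) =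
      lam ^ 2 * cherryZ lam ζ (insert z A)
        (addPair s(b, z) (insert z A)ᶜ (addPair s(a, z) (insert z A)ᶜ K)) := by
  unfold cherryZ
  rw [Finset.mul_sum]
  refine Finset.sum_congr rfl fun S hS => ?_
  have h1 : ∀ c ∈ A, s(c, z) ∉ S := by
    intro c hc h
    have := mem_outerPairs.1 (Finset.mem_powerset.1 hS h)
    exact this.2 ⟨Finset.mem_insert_of_mem hc, Finset.mem_insert_self _ _⟩
  have hne : s(a, z) ≠ s(b, z) := by
    intro h
    rcases Sym2.eq_iff.1 h with h | h
    · exact hab h.1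
    · exact hz (h.1 ▸ ha)
  have h2 : S ∪ {s(a, z), s(b, z)} = insert s(a, z) (insert s(b, z) S) := by
    ext e; simp only [Finset.mem_union, Finset.mem_insert, Finset.mem_singleton]; tauto
  rw [h2, exponent_insert_insert hK ha hb hab hz hp (Finset.mem_powerset.1 hS),
    Finset.card_insert_of_notMem, Finset.card_insert_of_notMem (h1 b hb), pow_add, pow_add]
  · ring
  · rw [Finset.mem_insert, not_or]
    exact ⟨hne, h1 a ha⟩

lemma le_cherryPart (h0 : 0 ≤ lam) (hζ1 : ζ ≤ 1) {A : Finset V} {K : V → Finset (Sym2 V)}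
    (hK : ∀ x, ∀ p ∈ K x, ¬ p.IsDiag ∧ ∀ v ∈ p, v ∈ A) {a b z : V} (ha : a ∈ A) (hb : b ∈ A)
    (hab : a ≠ b) (hz : z ∉ A) (hp : s(a, b) ∉ K z) :
    lam ^ 2 * cherryZ lam ζ (insert z A)
        (addPair s(b, z) (insert z A)ᶜ (addPair s(a, z) (insert z A)ᶜ K))
      ≤ cherryPart lam ζ A K a b z := by
  rw [← cherryPart_main hK ha hb hab hz hp, cherryPart_eq ha hb hz]
  refine Finset.single_le_sum (f := fun R => ∑ S ∈ (outerPairs (insert z A)).powerset,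
        lam ^ (S ∪ R).card * (1 - ζ) ^ (triIn (S ∪ R) + cherryIn K (S ∪ R))) (fun R _ => ?_) ?_
  · exact Finset.sum_nonneg fun _ _ =>
      mul_nonneg (pow_nonneg h0 _) (pow_nonneg (by linarith) _)
  · simp only [Finset.mem_filter, Finset.mem_powerset, Finset.Subset.refl, and_true]
    intro e he
    simp only [Finset.mem_insert, Finset.mem_singleton] at he
    rw [Finset.mem_image]
    rcases he with rfl | rfl
    exacts [⟨a, ha, rfl⟩, ⟨b, hb, rfl⟩]

lemma cherryPart_le (h0 : 0 ≤ lam) (h1 : lam ≤ 1) (hζ0 : 0 ≤ ζ) (hζ1 : ζ ≤ 1) {A : Finset V}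
    {K : V → Finset (Sym2 V)}
    (hK : ∀ x, ∀ p ∈ K x, ¬ p.IsDiag ∧ ∀ v ∈ p, v ∈ A) {a b z : V} (ha : a ∈ A) (hb : b ∈ A)
    (hab : a ≠ b) (hz : z ∉ A) (hp : s(a, b) ∉ K z) :
    cherryPart lam ζ A K a b z ≤ lam ^ 2 * cherryZ lam ζ (insert z A)
        (addPair s(b, z) (insert z A)ᶜ (addPair s(a, z) (insert z A)ᶜ K))
      + 2 ^ A.card * lam ^ 3 * cherryZ lam ζ (insert z A) K := by
  have hne : s(a, z) ≠ s(b, z) := by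
    intro h
    rcases Sym2.eq_iff.1 h with h | h
    · exact hab h.1
    · exact hz (h.1 ▸ ha)
  rw [← cherryPart_main hK ha hb hab hz hp, cherryPart_eq ha hb hz]
  have hm : ({s(a, z), s(b, z)} : Finset (Sym2 V)) ∈
      (A.image fun a => s(a, z)).powerset.filter (fun R => {s(a, z), s(b, z)} ⊆ R) := by
    simp only [Finset.mem_filter, Finset.mem_powerset, Finset.Subset.refl, and_true]
    intro e he
    simp only [Finset.mem_insert, Finset.mem_singleton] at he
    rw [Finset.mem_image]
    rcases he with rfl | rfl
    exacts [⟨a, ha, rfl⟩, ⟨b, hb, rfl⟩]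
  rw [← Finset.add_sum_erase _ _ hm]
  gcongr
  have hQ := cherryZ_nonneg h0 hζ1 (insert z A) K
  refine (Finset.sum_le_card_nsmul _ _ (lam ^ 3 * cherryZ lam ζ (insert z A) K) ?_).trans ?_
  · intro R hR
    rw [Finset.mem_erase, Finset.mem_filter, Finset.mem_powerset] at hR
    refine (cherryZ_part_le h0 hζ0 hζ1 K hR.2.1).trans ?_
    gcongr ?_ * _
    refine pow_le_pow_of_le_one h0 h1 ?_
    have := Finset.card_lt_card (lt_of_le_of_ne hR.2.2 (Ne.symm hR.1))
    rw [Finset.card_pair hne] at this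
    exact this
  · rw [nsmul_eq_mul, mul_assoc]
    gcongr
    have h2 : (((A.image fun a => s(a, z)).powerset.filter
        (fun R => {s(a, z), s(b, z)} ⊆ R)).erase {s(a, z), s(b, z)}).card ≤ 2 ^ A.card := by
      refine (Finset.card_erase_le.trans (Finset.card_filter_le _ _)).trans ?_
      rw [Finset.card_powerset, card_image_pair]
    exact_mod_cast h2

/-- `l` and `u` bound the effect of adding a fresh pair of cherry constraints at any set of `s`
exposed vertices. -/
def PairBounds (V : Type*) [Fintype V] (lam ζ : ℝ) (s : ℕ) (l u : ℝ) : Prop :=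
  ∀ (A : Finset V) (K : V → Finset (Sym2 V)) (a b : V), A.card = s →
    (∀ x, ∀ p ∈ K x, ¬ p.IsDiag ∧ ∀ v ∈ p, v ∈ A) → a ∈ A → b ∈ A → a ≠ b →
    (∀ x ∉ A, s(a, b) ∉ K x) →
    l * cherryZ lam ζ A K ≤ cherryZ lam ζ A (addPair s(a, b) Aᶜ K) ∧
      cherryZ lam ζ A (addPair s(a, b) Aᶜ K) ≤ u * cherryZ lam ζ A K

lemma pairBounds_zero (h0 : 0 ≤ lam) (hζ0 : 0 ≤ ζ) (hζ1 : ζ ≤ 1) (s : ℕ) :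
    PairBounds V lam ζ s 0 1 := by
  intro A K a b _ _ _ _ _ hp
  refine ⟨by rw [zero_mul]; exact cherryZ_nonneg h0 hζ1 _ _, ?_⟩
  rw [one_mul]
  unfold cherryZ
  refine Finset.sum_le_sum fun S _ => ?_
  rw [cherryIn_addPair (by simpa using hp)]
  have := pow_le_pow_of_le_one (a := 1 - ζ) (by linarith) (by linarith)
    (show triIn S + cherryIn K S ≤ triIn S + (cherryIn K S +
      ((Aᶜ : Finset V).filter fun x => x ∈ linkIn s(a, b) S).card) by omega)
  gcongr

/-- One step of the tree recursion for the bounds on adding a pair. -/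
lemma PairBounds.step (h0 : 0 ≤ lam) (h1 : lam ≤ 1) (hζ0 : 0 ≤ ζ) (hζ1 : ζ ≤ 1) {s : ℕ} {l u : ℝ}
    (hl : 0 ≤ l) (hu : 0 ≤ u) (H : PairBounds V lam ζ (s + 1) l u)
    (hsmall : ζ * (lam ^ 2 * u ^ 2 + 2 ^ s * lam ^ 3) ≤ 1)
    (hsmall' : ζ * (lam ^ 2 * l ^ 2 / (1 + lam) ^ s) ≤ 1) :
    PairBounds V lam ζ s
      ((1 - ζ * (lam ^ 2 * u ^ 2 + 2 ^ s * lam ^ 3)) ^ (Fintype.card V - s))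
      ((1 - ζ * (lam ^ 2 * l ^ 2 / (1 + lam) ^ s)) ^ (Fintype.card V - s)) := by
  intro A K a b hA hK ha hb hab hp
  have key : ∀ K : V → Finset (Sym2 V), (∀ x, ∀ p ∈ K x, ¬ p.IsDiag ∧ ∀ v ∈ p, v ∈ A) →
      ∀ z ∉ A, s(a, b) ∉ K z →
      (1 - ζ * (lam ^ 2 * u ^ 2 + 2 ^ s * lam ^ 3)) * cherryZ lam ζ A K
        ≤ cherryZ lam ζ A (addPair s(a, b) {z} K) ∧
      cherryZ lam ζ A (addPair s(a, b) {z} K)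
        ≤ (1 - ζ * (lam ^ 2 * l ^ 2 / (1 + lam) ^ s)) * cherryZ lam ζ A K := by
    intro K hK z hz hpz
    have hA' : (insert z A).card = s + 1 := by rw [Finset.card_insert_of_notMem hz, hA]
    have hKm : ∀ x, ∀ p ∈ K x, ¬ p.IsDiag ∧ ∀ v ∈ p, v ∈ insert z A := fun x p hp =>
      ⟨(hK x p hp).1, fun v hv => Finset.mem_insert_of_mem ((hK x p hp).2 v hv)⟩
    have hzm := Finset.mem_insert_self z A
    have ham := Finset.mem_insert_of_mem (b := z) ha
    have hbm := Finset.mem_insert_of_mem (b := z) hb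
    have haz : a ≠ z := fun h => hz (h ▸ ha)
    have hbz : b ≠ z := fun h => hz (h ▸ hb)
    have hnK : ∀ c x, s(c, z) ∉ K x := fun c x h => hz ((hK x _ h).2 z (by simp))
    obtain ⟨B1, B2⟩ := H (insert z A) K a z hA' hKm ham hzm haz fun x _ => hnK a x
    obtain ⟨C1, C2⟩ := H (insert z A) (addPair s(a, z) (insert z A)ᶜ K) b z hA'
      (addPair_valid hKm ham hzm haz) hbm hzm hbz (by
        intro x hx
        rw [addPair, if_pos (Finset.mem_compl.2 hx), Finset.mem_insert, not_or]
        refine ⟨fun h => ?_, hnK b x⟩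
        rcases Sym2.eq_iff.1 h with h | h
        · exact hab h.1.symm
        · exact hbz h.1)
    have D1 := le_cherryPart h0 hζ1 hK ha hb hab hz hpz
    have D2 := cherryPart_le h0 h1 hζ0 hζ1 hK ha hb hab hz hpz
    have E1 := cherryZ_insert_le h0 hζ1 K hz
    have E2 := cherryZ_le_insert h0 hζ0 hζ1 K hz
    rw [hA] at D2 E2
    rw [cherryZ_addPair_singleton hpz]
    set q0 := cherryZ lam ζ (insert z A) K
    set q1 := cherryZ lam ζ (insert z A) (addPair s(a, z) (insert z A)ᶜ K)
    set q2 := cherryZ lam ζ (insert z A)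
      (addPair s(b, z) (insert z A)ᶜ (addPair s(a, z) (insert z A)ᶜ K))
    have hq0 : 0 ≤ q0 := cherryZ_nonneg h0 hζ1 _ _
    have hpos : 0 < (1 + lam) ^ s := by positivity
    constructor
    · have : cherryPart lam ζ A K a b z
          ≤ (lam ^ 2 * u ^ 2 + 2 ^ s * lam ^ 3) * cherryZ lam ζ A K := by
        calc _ ≤ lam ^ 2 * q2 + 2 ^ s * lam ^ 3 * q0 := D2
          _ ≤ lam ^ 2 * (u * (u * q0)) + 2 ^ s * lam ^ 3 * q0 := by
              gcongr
              exact C2.trans (by gcongr)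
          _ = (lam ^ 2 * u ^ 2 + 2 ^ s * lam ^ 3) * q0 := by ring
          _ ≤ _ := by gcongr
      nlinarith [mul_le_mul_of_nonneg_left this hζ0]
    · have : lam ^ 2 * l ^ 2 / (1 + lam) ^ s * cherryZ lam ζ A K
          ≤ cherryPart lam ζ A K a b z := by
        calc _ ≤ lam ^ 2 * l ^ 2 / (1 + lam) ^ s * ((1 + lam) ^ s * q0) := by gcongr
          _ = lam ^ 2 * (l * (l * q0)) := by field_simp
          _ ≤ lam ^ 2 * q2 := by
              gcongr
              exact le_trans (by gcongr) C1
          _ ≤ _ := D1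
      nlinarith [mul_le_mul_of_nonneg_left this hζ0]
  have ind : ∀ X : Finset V, X ⊆ Aᶜ →
      (1 - ζ * (lam ^ 2 * u ^ 2 + 2 ^ s * lam ^ 3)) ^ X.card * cherryZ lam ζ A K
        ≤ cherryZ lam ζ A (addPair s(a, b) X K) ∧
      cherryZ lam ζ A (addPair s(a, b) X K)
        ≤ (1 - ζ * (lam ^ 2 * l ^ 2 / (1 + lam) ^ s)) ^ X.card * cherryZ lam ζ A K := by
    intro X
    induction X using Finset.induction_on with
    | empty =>
      intro _
      have : addPair s(a, b) ∅ K = K := by funext x; simp [addPair]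
      simp [this]
    | insert z X hzX ih =>
      intro hX
      obtain ⟨I1, I2⟩ := ih ((Finset.subset_insert _ _).trans hX)
      have hzA : z ∉ A := Finset.mem_compl.1 (hX (Finset.mem_insert_self _ _))
      have hadd : addPair s(a, b) (insert z X) K
          = addPair s(a, b) {z} (addPair s(a, b) X K) := by
        funext x
        by_cases hxz : x = z
        · subst hxz; simp [addPair, hzX]
        · simp [addPair, hxz]
      obtain ⟨J1, J2⟩ := key (addPair s(a, b) X K) (addPair_valid hK ha hb hab) z hzA (by
        simpa [addPair, hzX] using hp z hzA)
      rw [hadd, Finset.card_insert_of_notMem hzX, pow_succ' _ X.card, pow_succ' _ X.card]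
      simp only [mul_assoc (_ - _)]
      refine ⟨le_trans ?_ J1, J2.trans ?_⟩
      · exact mul_le_mul_of_nonneg_left I1 (sub_nonneg.2 hsmall)
      · exact mul_le_mul_of_nonneg_left I2 (sub_nonneg.2 hsmall')
  have := ind Aᶜ (Finset.Subset.refl _)
  rwa [Finset.card_compl, hA] at this

end Recursion

section Limits

lemma tendsto_one_add_pow_sub {g : ℕ → ℝ} {t : ℝ} (s : ℕ)
    (hg : Tendsto (fun n : ℕ => (n : ℝ) * g n) atTop (nhds t)) :
    Tendsto (fun n => (1 + g n) ^ (n - s)) atTop (nhds (Real.exp t)) := by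
  have h0 : Tendsto g atTop (nhds 0) := by
    have := hg.mul (tendsto_inv_atTop_nhds_zero_nat (𝕜 := ℝ))
    rw [mul_zero] at this
    refine this.congr' ?_
    filter_upwards [eventually_gt_atTop 0] with n hn
    have : (n : ℝ) ≠ 0 := by positivity
    field_simp
  have h1 : Tendsto (fun n => 1 + g n) atTop (nhds 1) := by
    simpa using h0.const_add 1
  have h2 := (Real.tendsto_one_add_pow_exp_of_tendsto hg).div (h1.pow s) (by simp)
  simp only [one_pow, div_one] at h2
  refine h2.congr' ?_
  filter_upwards [eventually_ge_atTop s, h1.eventually_const_lt zero_lt_one] with n hn hpos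
  rw [pow_sub₀ _ hpos.ne' hn]
  rfl

/-- The pair `(x, y)` bounds, in the limit of large `n`, the effect of adding a fresh pair of cherry
constraints when the activity is `c / √n`. -/
def LimitBounds (c ζ x y : ℝ) : Prop :=
  ∀ s : ℕ, ∃ l u : ℕ → ℝ,
    (∀ᶠ n : ℕ in atTop, 0 ≤ l n ∧ 0 ≤ u n ∧ PairBounds (Fin n) (c / √n) ζ s (l n) (u n)) ∧
    Tendsto l atTop (nhds x) ∧ Tendsto u atTop (nhds y)

lemma tendsto_div_sqrt (c : ℝ) : Tendsto (fun n : ℕ => c / √(n : ℝ)) atTop (nhds 0) :=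
  tendsto_const_nhds.div_atTop
    (Real.tendsto_sqrt_atTop.comp tendsto_natCast_atTop_atTop)

variable {c ζ x y : ℝ}

lemma LimitBounds.step (hc : 0 ≤ c) (hζ0 : 0 ≤ ζ) (hζ1 : ζ ≤ 1) (h : LimitBounds c ζ x y) :
    LimitBounds c ζ (Real.exp (-(ζ * c ^ 2) * y ^ 2)) (Real.exp (-(ζ * c ^ 2) * x ^ 2)) := by
  intro s
  obtain ⟨l, u, hlu, hl, hu⟩ := h (s + 1)
  have hlam := tendsto_div_sqrt c
  have h1lam : Tendsto (fun n : ℕ => 1 + c / √(n : ℝ)) atTop (nhds 1) := by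
    simpa using hlam.const_add 1
  have hsq : ∀ n : ℕ, 0 < n → (n : ℝ) * (c / √(n : ℝ)) ^ 2 = c ^ 2 := by
    intro n hn
    have : (0 : ℝ) < n := by positivity
    rw [div_pow, Real.sq_sqrt this.le]
    field_simp
  have hα : Tendsto (fun n : ℕ => ζ * ((c / √(n : ℝ)) ^ 2 * u n ^ 2 + 2 ^ s * (c / √(n : ℝ)) ^ 3))
      atTop (nhds 0) := by
    have := (((hlam.pow 2).mul (hu.pow 2)).add ((hlam.pow 3).const_mul (2 ^ s))).const_mul ζ
    simpa using this
  have hγ : Tendsto (fun n : ℕ => ζ * ((c / √(n : ℝ)) ^ 2 * l n ^ 2 / (1 + c / √(n : ℝ)) ^ s))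
      atTop (nhds 0) := by
    have := (((hlam.pow 2).mul (hl.pow 2)).div (h1lam.pow s) (by simp)).const_mul ζ
    simpa using this
  refine ⟨fun n =>
    (1 + -(ζ * ((c / √(n : ℝ)) ^ 2 * u n ^ 2 + 2 ^ s * (c / √(n : ℝ)) ^ 3))) ^ (n - s),
    fun n => (1 + -(ζ * ((c / √(n : ℝ)) ^ 2 * l n ^ 2 / (1 + c / √(n : ℝ)) ^ s))) ^ (n - s),
    ?_, ?_, ?_⟩
  · filter_upwards [hlu, hα.eventually_le_const zero_lt_one, hγ.eventually_le_const zero_lt_one,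
      hlam.eventually_le_const zero_lt_one] with n hn hn1 hn2 hn3
    have := hn.2.2.step (by positivity) hn3 hζ0 hζ1 hn.1 hn.2.1 hn1 hn2
    rw [Fintype.card_fin] at this
    refine ⟨pow_nonneg (by linarith) _, pow_nonneg (by linarith) _, ?_⟩
    simpa only [← sub_eq_add_neg] using this
  · apply tendsto_one_add_pow_sub
    have h1 : Tendsto (fun n : ℕ => -ζ * (c ^ 2 * u n ^ 2 + 2 ^ s * c ^ 2 * (c / √(n : ℝ))))
        atTop (nhds (-ζ * (c ^ 2 * y ^ 2 + 2 ^ s * c ^ 2 * 0))) :=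
      (((hu.pow 2).const_mul _).add (hlam.const_mul _)).const_mul _
    rw [show -ζ * (c ^ 2 * y ^ 2 + 2 ^ s * c ^ 2 * 0) = -(ζ * c ^ 2) * y ^ 2 by ring] at h1
    refine h1.congr' ?_
    filter_upwards [eventually_gt_atTop 0] with n hn
    rw [← hsq n hn]
    ring
  · apply tendsto_one_add_pow_sub
    have h1 : Tendsto (fun n : ℕ => -ζ * (c ^ 2 * l n ^ 2 / (1 + c / √(n : ℝ)) ^ s))
        atTop (nhds (-ζ * (c ^ 2 * x ^ 2 / 1 ^ s))) :=
      (((hl.pow 2).const_mul _).div (h1lam.pow s) (by simp)).const_mul _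
    rw [show -ζ * (c ^ 2 * x ^ 2 / 1 ^ s) = -(ζ * c ^ 2) * x ^ 2 by simp; ring] at h1
    refine h1.congr' ?_
    filter_upwards [eventually_gt_atTop 0] with n hn
    rw [← hsq n hn]
    ring

lemma limitBounds_zero_one (hc : 0 ≤ c) (hζ0 : 0 ≤ ζ) (hζ1 : ζ ≤ 1) : LimitBounds c ζ 0 1 := by
  intro s
  refine ⟨fun _ => 0, fun _ => 1, ?_, tendsto_const_nhds, tendsto_const_nhds⟩
  exact Eventually.of_forall fun n =>
    ⟨le_rfl, zero_le_one, pairBounds_zero (by positivity) hζ0 hζ1 s⟩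

lemma limitBounds_iterate (hc : 0 ≤ c) (hζ0 : 0 ≤ ζ) (hζ1 : ζ ≤ 1) (k : ℕ) :
    LimitBounds c ζ
      ((fun v => Real.exp (-(ζ * c ^ 2) * Real.exp (-(ζ * c ^ 2) * v ^ 2) ^ 2))^[k] 0)
      ((fun v => Real.exp (-(ζ * c ^ 2) * Real.exp (-(ζ * c ^ 2) * v ^ 2) ^ 2))^[k] 1) := by
  induction k with
  | zero => exact limitBounds_zero_one hc hζ0 hζ1
  | succ k ih =>
    rw [Function.iterate_succ_apply', Function.iterate_succ_apply']
    exact (ih.step hc hζ0 hζ1).step hc hζ0 hζ1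

lemma sq_mul_exp_le {a : ℝ} (v : ℝ) :
    (v * Real.exp (-a * v ^ 2)) ^ 2 * (2 * a * Real.exp 1) ≤ 1 := by
  have h := Real.add_one_le_exp (2 * a * v ^ 2 - 1)
  have h2 : (v * Real.exp (-a * v ^ 2)) ^ 2 * (2 * a * Real.exp 1)
      = (2 * a * v ^ 2) * (Real.exp (-a * v ^ 2) * Real.exp (-a * v ^ 2) * Real.exp 1) := by ring
  rw [h2, ← Real.exp_add, ← Real.exp_add]
  calc _ ≤ Real.exp (2 * a * v ^ 2 - 1) * Real.exp (-a * v ^ 2 + -a * v ^ 2 + 1) := by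
        gcongr; linarith
    _ = 1 := by rw [← Real.exp_add, Real.exp_eq_one_iff]; ring

/-- The second iterate of `v ↦ exp (-a v²)` is Lipschitz with constant `2 a / e`. -/
lemma abs_exp_exp_sub_le {a : ℝ} (ha : 0 ≤ a) (v w : ℝ) :
    |Real.exp (-a * Real.exp (-a * v ^ 2) ^ 2) - Real.exp (-a * Real.exp (-a * w ^ 2) ^ 2)|
      ≤ 2 * a / Real.exp 1 * |v - w| := by
  have hd : ∀ v : ℝ, HasDerivAt (fun v => Real.exp (-a * Real.exp (-a * v ^ 2) ^ 2))
      (4 * a ^ 2 * ((v * Real.exp (-a * v ^ 2)) *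
        (Real.exp (-a * v ^ 2) * Real.exp (-a * Real.exp (-a * v ^ 2) ^ 2)))) v := by
    intro v
    have h1 : HasDerivAt (fun v : ℝ => -a * v ^ 2) (-a * (2 * v)) v := by
      simpa using (hasDerivAt_pow 2 v).const_mul (-a)
    have h2 := ((h1.exp.pow 2).const_mul (-a)).exp
    refine HasDerivAt.congr_deriv h2 ?_
    rw [show ((fun x : ℝ => Real.exp (-a * x ^ 2)) ^ 2) v = Real.exp (-a * v ^ 2) ^ 2 from rfl]
    push_cast
    ring
  have hb : ∀ v : ℝ, ‖4 * a ^ 2 * ((v * Real.exp (-a * v ^ 2)) *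
      (Real.exp (-a * v ^ 2) * Real.exp (-a * Real.exp (-a * v ^ 2) ^ 2)))‖
        ≤ 2 * a / Real.exp 1 := by
    intro v
    have h1 := sq_mul_exp_le (a := a) v
    have h2 := sq_mul_exp_le (a := a) (Real.exp (-a * v ^ 2))
    set p := v * Real.exp (-a * v ^ 2)
    set q := Real.exp (-a * v ^ 2) * Real.exp (-a * Real.exp (-a * v ^ 2) ^ 2)
    rw [norm_mul, Real.norm_of_nonneg (by positivity), Real.norm_eq_abs,
      le_div_iff₀ (Real.exp_pos 1)]
    have h3 : |p * q| ≤ (p ^ 2 + q ^ 2) / 2 := by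
      rw [abs_le]; constructor <;> nlinarith [sq_nonneg (p + q), sq_nonneg (p - q)]
    calc 4 * a ^ 2 * |p * q| * Real.exp 1
        ≤ 4 * a ^ 2 * ((p ^ 2 + q ^ 2) / 2) * Real.exp 1 := by gcongr
      _ = a * (p ^ 2 * (2 * a * Real.exp 1) + q ^ 2 * (2 * a * Real.exp 1)) := by ring
      _ ≤ a * (1 + 1) := by gcongr
      _ = 2 * a := by ring
  have := Convex.norm_image_sub_le_of_norm_hasDerivWithin_le (s := Set.univ)
    (fun v _ => (hd v).hasDerivWithinAt) (fun v _ => hb v) convex_univ (Set.mem_univ w)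
    (Set.mem_univ v)
  simpa [Real.norm_eq_abs] using this

lemma tendsto_iterate_of_contract {f : ℝ → ℝ} {q r : ℝ} (hq0 : 0 ≤ q) (hq : q < 1) (hr : f r = r)
    (hf : ∀ v w, |f v - f w| ≤ q * |v - w|) (v : ℝ) :
    Tendsto (fun k => f^[k] v) atTop (nhds r) := by
  have h : ∀ k, |f^[k] v - r| ≤ q ^ k * |v - r| := by
    intro k
    induction k with
    | zero => simp
    | succ k ih =>
      rw [Function.iterate_succ_apply']
      calc _ = |f (f^[k] v) - f r| := by rw [hr]
        _ ≤ q * |f^[k] v - r| := hf _ _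
        _ ≤ q * (q ^ k * |v - r|) := by gcongr
        _ = _ := by ring
  rw [tendsto_iff_dist_tendsto_zero]
  refine squeeze_zero (g := fun k => q ^ k * |v - r|) (fun _ => dist_nonneg)
    (fun k => (Real.dist_eq _ _).trans_le (h k)) ?_
  simpa using (tendsto_pow_atTop_nhds_zero_of_lt_one hq0 hq).mul_const |v - r|

/-- When `ζ t² < 1/2`, the tree recursion at activity `t exp (ζ t²) / √n` pins down the effect of
adding a pair. -/
lemma limitBounds_near {t : ℝ} (ht : 0 ≤ t) (hζ0 : 0 ≤ ζ) (hζ1 : ζ ≤ 1) (hw : ζ * t ^ 2 < 1 / 2)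
    {ε : ℝ} (hε : 0 < ε) :
    ∃ x y, LimitBounds (t * Real.exp (ζ * t ^ 2)) ζ x y ∧ Real.exp (-(ζ * t ^ 2)) - ε < x ∧
      y < Real.exp (-(ζ * t ^ 2)) + ε := by
  set w := ζ * t ^ 2 with hwdef
  set c := t * Real.exp w with hc
  set r := Real.exp (-w) with hr
  have ha : ζ * c ^ 2 = w * Real.exp w ^ 2 := by rw [hc, hwdef]; ring
  have hw0 : 0 ≤ w := by positivity
  have ha0 : 0 ≤ ζ * c ^ 2 := by positivity
  have hfix : Real.exp (-(ζ * c ^ 2) * r ^ 2) = r := by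
    rw [ha, hr]
    congr 1
    have : Real.exp w * Real.exp (-w) = 1 := by rw [← Real.exp_add]; simp
    calc _ = -w * (Real.exp w * Real.exp (-w)) ^ 2 := by ring
      _ = _ := by rw [this]; ring
  have hq : 2 * (ζ * c ^ 2) / Real.exp 1 < 1 := by
    rw [div_lt_one (Real.exp_pos 1), ha, ← Real.exp_nat_mul]
    have h1 : Real.exp ((2 : ℕ) * w) ≤ Real.exp 1 := Real.exp_le_exp.2 (by push_cast; linarith)
    calc 2 * (w * Real.exp ((2 : ℕ) * w)) ≤ 2 * (w * Real.exp 1) := by gcongr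
      _ < Real.exp 1 := by nlinarith [Real.exp_pos 1]
  have hconv := tendsto_iterate_of_contract
    (f := fun v => Real.exp (-(ζ * c ^ 2) * Real.exp (-(ζ * c ^ 2) * v ^ 2) ^ 2))
    (q := 2 * (ζ * c ^ 2) / Real.exp 1) (r := r) (by positivity) hq (by simp only [hfix])
    (abs_exp_exp_sub_le ha0)
  obtain ⟨k, hk1, hk2⟩ := (((hconv 0).eventually_const_lt (show r - ε < r by linarith)).and
    ((hconv 1).eventually_lt_const (show r < r + ε by linarith))).exists
  exact ⟨_, _, limitBounds_iterate (by positivity) hζ0 hζ1 k, hk1, hk2⟩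

end Limits

section Derivative

/-- The partition function of graphs on `V` with a factor `lam` for each edge and a factor `1 - ζ`
for each triangle. -/
def triZ (V : Type*) [Fintype V] (ζ lam : ℝ) : ℝ :=
  ∑ S ∈ (outerPairs (∅ : Finset V)).powerset, lam ^ S.card * (1 - ζ) ^ triIn S

/-- The derivative of `triZ` in `lam`. -/
def triZDeriv (V : Type*) [Fintype V] (ζ lam : ℝ) : ℝ :=
  ∑ S ∈ (outerPairs (∅ : Finset V)).powerset, S.card * lam ^ (S.card - 1) * (1 - ζ) ^ triIn S

variable {V : Type*} [Fintype V] {lam ζ : ℝ}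

lemma hasDerivAt_triZ (ζ lam : ℝ) : HasDerivAt (triZ V ζ) (triZDeriv V ζ lam) lam := by
  unfold triZ triZDeriv
  exact HasDerivAt.fun_sum fun S _ => (hasDerivAt_pow S.card lam).mul_const _

lemma continuous_triZDeriv (ζ : ℝ) : Continuous (triZDeriv V ζ) := by
  unfold triZDeriv
  fun_prop

lemma triIn_empty : triIn (∅ : Finset (Sym2 V)) = 0 := by
  unfold triIn
  rw [Finset.card_eq_zero, Finset.filter_eq_empty_iff]
  intro T hT hT2
  rw [Finset.mem_powersetCard] at hT
  obtain ⟨x, hx, y, hy, hxy⟩ := Finset.one_lt_card.1 (by omega : 1 < T.card)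
  exact absurd (hT2 x hx y hy hxy) (Finset.notMem_empty _)

lemma one_le_triZ (h0 : 0 ≤ lam) (hζ1 : ζ ≤ 1) : 1 ≤ triZ V ζ lam := by
  have h := Finset.single_le_sum
    (f := fun S : Finset (Sym2 V) => lam ^ S.card * (1 - ζ) ^ triIn S)
    (s := (outerPairs (∅ : Finset V)).powerset)
    (fun S _ => mul_nonneg (pow_nonneg h0 _) (pow_nonneg (by linarith) _))
    (Finset.empty_mem_powerset _)
  simpa [triIn_empty, triZ] using h

lemma outerPairs_pair {u v : V} :
    outerPairs ({u, v} : Finset V) = (outerPairs ∅).erase s(u, v) := by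
  ext e
  induction e with
  | _ x y =>
    simp only [Finset.mem_erase, mem_outerPairs, Finset.mem_insert, Finset.mem_singleton,
      Finset.notMem_empty, ne_eq, Sym2.eq_iff]
    constructor
    · rintro ⟨h1, h2⟩
      exact ⟨by tauto, h1, by tauto⟩
    · rintro ⟨h1, h2, -⟩
      refine ⟨h2, ?_⟩
      rintro ⟨rfl | rfl, rfl | rfl⟩ <;> simp_all

/-- The total weight, without the factor of the edge `e`, of the graphs containing `e`. -/
def edgePart (lam ζ : ℝ) (e : Sym2 V) : ℝ :=
  ∑ S ∈ ((outerPairs ∅).erase e).powerset, lam ^ S.card * (1 - ζ) ^ triIn (insert e S)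

lemma sum_powerset_erase_of_mem {α : Type*} [DecidableEq α] {E : Finset α} {e : α} (he : e ∈ E)
    (f : Finset α → ℝ) : ∑ S ∈ E.powerset, f S
      = ∑ S ∈ (E.erase e).powerset, f S + ∑ S ∈ (E.erase e).powerset, f (insert e S) := by
  conv_lhs => rw [← Finset.insert_erase he]
  rw [Finset.sum_powerset_insert (Finset.notMem_erase e E)]

lemma cherryIn_empty (S : Finset (Sym2 V)) : cherryIn (fun _ => ∅) S = 0 := by
  simp [cherryIn]

lemma edgePart_eq_cherryZ {u v : V} (huv : u ≠ v) :
    edgePart lam ζ s(u, v) =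
      cherryZ lam ζ {u, v} (addPair s(u, v) ({u, v} : Finset V)ᶜ fun _ => ∅) := by
  unfold edgePart cherryZ
  rw [outerPairs_pair]
  refine Finset.sum_congr rfl fun S hS => ?_
  rw [Finset.mem_powerset] at hS
  have hd : ∀ e ∈ S, ¬ e.IsDiag := by
    intro e he
    have := Finset.mem_of_mem_erase (hS he)
    simp only [outerPairs, Finset.mem_filter] at this
    exact this.2.1
  rw [triIn_insert huv hd fun h => Finset.notMem_erase _ _ (hS h),
    cherryIn_addPair (by simp), cherryIn_empty, zero_add]
  congr 4
  symm
  rw [Finset.filter_mem_eq_inter, Finset.inter_eq_right]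
  intro x hx
  rw [mem_linkIn] at hx
  simp only [Finset.mem_compl, Finset.mem_insert, Finset.mem_singleton]
  rintro (rfl | rfl)
  · exact hd _ hx.1 (by simp)
  · exact hd _ hx.2 (by simp)

lemma triZ_eq_add_edgePart {u v : V} (huv : u ≠ v) :
    triZ V ζ lam = cherryZ lam ζ ({u, v} : Finset V) (fun _ => ∅) +
      lam * edgePart lam ζ s(u, v) := by
  have he : s(u, v) ∈ outerPairs (∅ : Finset V) := by simp [mem_outerPairs, huv]
  unfold triZ cherryZ edgePart
  rw [sum_powerset_erase_of_mem he, outerPairs_pair, Finset.mul_sum]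
  congr 1
  · simp [cherryIn_empty]
  · refine Finset.sum_congr rfl fun S hS => ?_
    rw [Finset.card_insert_of_notMem fun h =>
      Finset.notMem_erase _ _ (Finset.mem_powerset.1 hS h), pow_succ']
    ring

lemma triZDeriv_eq_sum : triZDeriv V ζ lam = ∑ e ∈ outerPairs (∅ : Finset V), edgePart lam ζ e := by
  have h1 : ∀ e ∈ outerPairs (∅ : Finset V), edgePart lam ζ e =
      ∑ S ∈ (outerPairs (∅ : Finset V)).powerset,
        if e ∈ S then lam ^ (S.card - 1) * (1 - ζ) ^ triIn S else 0 := by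
    intro e he
    rw [sum_powerset_erase_of_mem he, Finset.sum_eq_zero, zero_add]
    · unfold edgePart
      refine Finset.sum_congr rfl fun S hS => ?_
      rw [if_pos (Finset.mem_insert_self _ _), Finset.card_insert_of_notMem fun h =>
        Finset.notMem_erase _ _ (Finset.mem_powerset.1 hS h), Nat.add_sub_cancel]
    · intro S hS
      rw [if_neg fun h => Finset.notMem_erase _ _ (Finset.mem_powerset.1 hS h)]
  rw [Finset.sum_congr rfl h1, Finset.sum_comm]
  unfold triZDeriv
  refine Finset.sum_congr rfl fun S hS => ?_
  rw [← Finset.sum_filter, Finset.sum_const, nsmul_eq_mul, Finset.filter_mem_eq_inter,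
    Finset.inter_eq_right.2 (Finset.mem_powerset.1 hS), mul_assoc]

lemma triZDeriv_bounds (h0 : 0 ≤ lam) (hζ1 : ζ ≤ 1) {l u : ℝ} (hl : 0 ≤ l)
    (hu : 0 ≤ u) (H : PairBounds V lam ζ 2 l u) :
    (outerPairs (∅ : Finset V)).card * (l / (1 + lam * u)) * triZ V ζ lam ≤ triZDeriv V ζ lam ∧
    triZDeriv V ζ lam ≤ (outerPairs (∅ : Finset V)).card * u * triZ V ζ lam := by
  have key : ∀ e ∈ outerPairs (∅ : Finset V),
      l / (1 + lam * u) * triZ V ζ lam ≤ edgePart lam ζ e ∧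
        edgePart lam ζ e ≤ u * triZ V ζ lam := by
    intro e he
    induction e with
    | _ x y =>
      have hxy : x ≠ y := (mem_outerPairs.1 he).1
      obtain ⟨B1, B2⟩ := H {x, y} (fun _ => ∅) x y (Finset.card_pair hxy) (by simp) (by simp)
        (by simp) hxy (by simp)
      rw [← edgePart_eq_cherryZ hxy] at B1 B2
      have hZ := triZ_eq_add_edgePart (lam := lam) (ζ := ζ) hxy
      have hq := cherryZ_nonneg h0 hζ1 ({x, y} : Finset V) fun _ => ∅
      set q := cherryZ lam ζ ({x, y} : Finset V) fun _ => ∅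
      constructor
      · rw [hZ, div_mul_eq_mul_div, div_le_iff₀ (by positivity)]
        nlinarith [mul_le_mul_of_nonneg_left B1 h0, mul_le_mul_of_nonneg_left B2 (mul_nonneg h0 hl),
          mul_le_mul_of_nonneg_left B1 (mul_nonneg h0 hu), mul_le_mul_of_nonneg_left B2 h0]
      · have : 0 ≤ edgePart lam ζ s(x, y) := (mul_nonneg hl hq).trans B1
        rw [hZ]
        nlinarith [mul_nonneg hu (mul_nonneg h0 this)]
  rw [triZDeriv_eq_sum]
  constructor
  · rw [mul_assoc, ← nsmul_eq_mul]
    exact Finset.card_nsmul_le_sum _ _ _ fun e he => (key e he).1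
  · rw [mul_assoc, ← nsmul_eq_mul]
    exact Finset.sum_le_card_nsmul _ _ _ fun e he => (key e he).2

lemma card_outerPairs_empty : (outerPairs (∅ : Finset V)).card = (Fintype.card V).choose 2 := by
  rw [← Sym2.card_subtype_not_diag, Fintype.card_subtype]
  congr 1
  ext e
  induction e with
  | _ x y => simp [mem_outerPairs]

end Derivative

section PartitionFunction

lemma tendsto_choose_two_div :
    Tendsto (fun n : ℕ => (n.choose 2 : ℝ) / (n : ℝ) ^ 2) atTop (nhds (1 / 2)) := by
  have h : Tendsto (fun n : ℕ => (1 - (n : ℝ)⁻¹) / 2) atTop (nhds ((1 - 0) / 2)) :=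
    ((tendsto_inv_atTop_nhds_zero_nat (𝕜 := ℝ)).const_sub 1).div_const 2
  rw [sub_zero] at h
  refine h.congr' ?_
  filter_upwards [eventually_gt_atTop 0] with n hn
  have : (n : ℝ) ≠ 0 := by positivity
  rw [Nat.cast_choose_two]
  field_simp

lemma choose_two_div_le (n : ℕ) : (n.choose 2 : ℝ) / (n : ℝ) ^ 2 ≤ 1 := by
  apply div_le_one_of_le₀ _ (by positivity)
  exact_mod_cast Nat.choose_le_pow n 2

variable {ζ : ℝ}

/-- The activity is `gibbsAct ζ t / √n`, in a Gibbs measure with about `t n^{3/2} / 2` edges. -/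
def gibbsAct (ζ t : ℝ) : ℝ := t * Real.exp (ζ * t ^ 2)

lemma hasDerivAt_gibbsAct (ζ t : ℝ) :
    HasDerivAt (gibbsAct ζ) ((1 + 2 * ζ * t ^ 2) * Real.exp (ζ * t ^ 2)) t := by
  have h1 : HasDerivAt (fun t : ℝ => ζ * t ^ 2) (ζ * (2 * t)) t := by
    simpa using (hasDerivAt_pow 2 t).const_mul ζ
  refine ((hasDerivAt_id t).mul h1.exp).congr_deriv ?_
  simp only [id_eq]
  ring

lemma gibbsAct_nonneg {t : ℝ} (ht : 0 ≤ t) : 0 ≤ gibbsAct ζ t := by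
  unfold gibbsAct; positivity

lemma tendsto_triZDeriv_div {t : ℝ} (ht : 0 ≤ t) (hζ0 : 0 ≤ ζ) (hζ1 : ζ ≤ 1)
    (hw : ζ * t ^ 2 < 1 / 2) :
    Tendsto (fun n : ℕ => triZDeriv (Fin n) ζ (gibbsAct ζ t / √n) /
        triZ (Fin n) ζ (gibbsAct ζ t / √n) / (n : ℝ) ^ 2)
      atTop (nhds (Real.exp (-(ζ * t ^ 2)) / 2)) := by
  have key : ∀ ε > 0, ∃ L U : ℕ → ℝ, ∃ x y, Tendsto L atTop (nhds x) ∧ Tendsto U atTop (nhds y) ∧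
      (Real.exp (-(ζ * t ^ 2)) - ε) / 2 < x ∧ y < (Real.exp (-(ζ * t ^ 2)) + ε) / 2 ∧
      ∀ᶠ n : ℕ in atTop, L n ≤ triZDeriv (Fin n) ζ (gibbsAct ζ t / √n) /
        triZ (Fin n) ζ (gibbsAct ζ t / √n) / (n : ℝ) ^ 2 ∧
        triZDeriv (Fin n) ζ (gibbsAct ζ t / √n) /
        triZ (Fin n) ζ (gibbsAct ζ t / √n) / (n : ℝ) ^ 2 ≤ U n := by
    intro ε hε
    obtain ⟨x, y, H, hx, hy⟩ := limitBounds_near ht hζ0 hζ1 hw hε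
    obtain ⟨l, u, hlu, hl, hu⟩ := H 2
    have hlam := tendsto_div_sqrt (gibbsAct ζ t)
    refine ⟨fun n => n.choose 2 / (n : ℝ) ^ 2 * (l n / (1 + gibbsAct ζ t / √(n : ℝ) * u n)),
      fun n => n.choose 2 / (n : ℝ) ^ 2 * u n, 1 / 2 * (x / (1 + 0 * y)), 1 / 2 * y,
      ?_, tendsto_choose_two_div.mul hu, ?_, ?_, ?_⟩
    · refine tendsto_choose_two_div.mul (hl.div ((hlam.mul hu).const_add 1) (by simp))
    · simp only [zero_mul, add_zero, div_one]; linarith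
    · linarith
    · filter_upwards [hlu, eventually_gt_atTop 0] with n hn hn0
      have h0 : 0 ≤ gibbsAct ζ t / √(n : ℝ) := div_nonneg (gibbsAct_nonneg ht) (by positivity)
      have hZ : 0 < triZ (Fin n) ζ (gibbsAct ζ t / √n) :=
        zero_lt_one.trans_le (one_le_triZ h0 hζ1)
      obtain ⟨B1, B2⟩ := triZDeriv_bounds h0 hζ1 hn.1 hn.2.1 hn.2.2
      rw [card_outerPairs_empty, Fintype.card_fin] at B1 B2
      have hn2 : (0 : ℝ) < (n : ℝ) ^ 2 := by positivity
      constructor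
      · rw [le_div_iff₀ hn2, le_div_iff₀ hZ]
        refine le_trans (le_of_eq ?_) B1
        field_simp
      · rw [div_le_iff₀ hn2, div_le_iff₀ hZ]
        refine B2.trans (le_of_eq ?_)
        field_simp
  rw [tendsto_order]
  constructor
  · intro a ha
    obtain ⟨L, U, x, y, hL, hU, hx, hy, h⟩ := key (Real.exp (-(ζ * t ^ 2)) - 2 * a) (by linarith)
    filter_upwards [h, hL.eventually_const_lt (show a < x by linarith)] with n h1 h2
    exact h2.trans_le h1.1
  · intro a ha
    obtain ⟨L, U, x, y, hL, hU, hx, hy, h⟩ := key (2 * a - Real.exp (-(ζ * t ^ 2))) (by linarith)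
    filter_upwards [h, hU.eventually_lt_const (show y < a by linarith)] with n h1 h2
    exact h1.2.trans_lt h2

lemma triZ_zero {V : Type*} [Fintype V] : triZ V ζ 0 = 1 := by
  unfold triZ
  rw [Finset.sum_eq_single ∅]
  · simp [triIn_empty]
  · intro S _ hS
    rw [zero_pow (by simpa using hS), zero_mul]
  · simp

lemma triZDeriv_nonneg {V : Type*} [Fintype V] {lam : ℝ} (h0 : 0 ≤ lam) (hζ1 : ζ ≤ 1) :
    0 ≤ triZDeriv V ζ lam :=
  Finset.sum_nonneg fun _ _ => mul_nonneg (mul_nonneg (Nat.cast_nonneg _) (pow_nonneg h0 _))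
    (pow_nonneg (by linarith) _)

lemma integral_one_add_sq (ζ b : ℝ) :
    ∫ t in (0 : ℝ)..b, (1 + 2 * ζ * t ^ 2) / 2 = b / 2 + ζ * b ^ 3 / 3 := by
  rw [intervalIntegral.integral_eq_sub_of_hasDerivAt (f := fun t => t / 2 + ζ * t ^ 3 / 3)]
  · simp
  · intro t _
    refine (((hasDerivAt_id t).div_const 2).add
      (((hasDerivAt_pow 3 t).const_mul ζ).div_const 3)).congr_deriv ?_
    push_cast
    ring
  · exact Continuous.intervalIntegrable (by fun_prop) _ _

/-- The asymptotics of the logarithm of the partition function. -/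
lemma tendsto_log_triZ {b : ℝ} (hb : 0 ≤ b) (hζ0 : 0 ≤ ζ) (hζ1 : ζ ≤ 1)
    (hw : ζ * b ^ 2 < 1 / 2) :
    Tendsto (fun n : ℕ => Real.log (triZ (Fin n) ζ (gibbsAct ζ b / √n)) / (n * √n))
      atTop (nhds (b / 2 + ζ * b ^ 3 / 3)) := by
  have hcont : Continuous (gibbsAct ζ) := by unfold gibbsAct; fun_prop
  set F : ℕ → ℝ → ℝ := fun n t => ((1 + 2 * ζ * t ^ 2) * Real.exp (ζ * t ^ 2)) *
    (triZDeriv (Fin n) ζ (gibbsAct ζ t / √n) / triZ (Fin n) ζ (gibbsAct ζ t / √n) / (n : ℝ) ^ 2)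
    with hF
  have hZpos : ∀ n : ℕ, ∀ t : ℝ, 0 ≤ t → 0 < triZ (Fin n) ζ (gibbsAct ζ t / √n) := fun n t ht =>
    zero_lt_one.trans_le (one_le_triZ (div_nonneg (gibbsAct_nonneg ht) (by positivity)) hζ1)
  have hFcont : ∀ n, ContinuousOn (F n) (Set.uIcc 0 b) := by
    intro n
    have h1 : Continuous fun t => triZDeriv (Fin n) ζ (gibbsAct ζ t / √n) :=
      (continuous_triZDeriv ζ).comp (hcont.div_const _)
    have h2 : Continuous fun t => triZ (Fin n) ζ (gibbsAct ζ t / √n) := by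
      refine Continuous.comp (g := triZ (Fin n) ζ) ?_ (hcont.div_const _)
      exact continuous_iff_continuousAt.2 fun t => (hasDerivAt_triZ ζ t).continuousAt
    refine ContinuousOn.mul (by fun_prop) ((h1.continuousOn.div h2.continuousOn ?_).div_const _)
    intro t ht
    rw [Set.uIcc_of_le hb] at ht
    exact (hZpos n t ht.1).ne'
  have hlog_eq : ∀ n : ℕ, 0 < n → Real.log (triZ (Fin n) ζ (gibbsAct ζ b / √n)) / (n * √n)
      = ∫ t in (0 : ℝ)..b, F n t := by
    intro n hn
    rw [intervalIntegral.integral_eq_sub_of_hasDerivAt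
      (f := fun t => Real.log (triZ (Fin n) ζ (gibbsAct ζ t / √n)) / (n * √n))]
    · simp [gibbsAct, triZ_zero]
    · intro t ht
      rw [Set.uIcc_of_le hb] at ht
      have hc : HasDerivAt (fun t => triZ (Fin n) ζ (gibbsAct ζ t / √n)) _ t :=
        HasDerivAt.comp (h₂ := triZ (Fin n) ζ) t (hasDerivAt_triZ ζ (gibbsAct ζ t / √n))
          ((hasDerivAt_gibbsAct ζ t).div_const (√(n : ℝ)))
      have hd := (hc.log (hZpos n t ht.1).ne').div_const ((n : ℝ) * √(n : ℝ))
      refine hd.congr_deriv ?_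
      simp only [hF]
      have h3 : (n : ℝ) ^ 2 = √(n : ℝ) * (n * √(n : ℝ)) := by
        rw [mul_left_comm, Real.mul_self_sqrt (by positivity), sq]
      rw [h3]
      have := (hZpos n t ht.1).ne'
      have h4 : √(n : ℝ) ≠ 0 := by positivity
      field_simp
    · exact (hFcont n).intervalIntegrable
  rw [← integral_one_add_sq]
  have hlim : Tendsto (fun n => ∫ t in (0 : ℝ)..b, F n t) atTop
      (nhds (∫ t in (0 : ℝ)..b, (1 + 2 * ζ * t ^ 2) / 2)) := by
    refine intervalIntegral.tendsto_integral_filter_of_dominated_convergence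
      (fun t => (1 + 2 * ζ * t ^ 2) * Real.exp (ζ * t ^ 2)) ?_ ?_ ?_ ?_
    · refine Eventually.of_forall fun n => ?_
      exact (((hFcont n).mono Set.uIoc_subset_uIcc).aestronglyMeasurable measurableSet_uIoc)
    · refine Eventually.of_forall fun n => Eventually.of_forall fun t ht => ?_
      rw [Set.uIoc_of_le hb] at ht
      have h0 : 0 ≤ gibbsAct ζ t / √(n : ℝ) := div_nonneg (gibbsAct_nonneg ht.1.le) (by positivity)
      have hD := triZDeriv_nonneg (V := Fin n) h0 hζ1
      have hZ := hZpos n t ht.1.le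
      have hB := (triZDeriv_bounds h0 hζ1 le_rfl zero_le_one
        (pairBounds_zero (V := Fin n) h0 hζ0 hζ1 2)).2
      rw [card_outerPairs_empty, Fintype.card_fin, mul_one] at hB
      rw [Real.norm_of_nonneg (by positivity)]
      refine mul_le_of_le_one_right (by positivity) ?_
      refine le_trans ?_ (choose_two_div_le n)
      gcongr
      rwa [div_le_iff₀ hZ]
    · exact Continuous.intervalIntegrable (by fun_prop) _ _
    · refine Eventually.of_forall fun t ht => ?_
      rw [Set.uIoc_of_le hb] at ht
      have hw' : ζ * t ^ 2 < 1 / 2 := by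
        refine lt_of_le_of_lt ?_ hw
        have : t ^ 2 ≤ b ^ 2 := by gcongr; exacts [ht.1.le, ht.2]
        gcongr
      have := (tendsto_triZDeriv_div ht.1.le hζ0 hζ1 hw').const_mul
        ((1 + 2 * ζ * t ^ 2) * Real.exp (ζ * t ^ 2))
      convert this using 2
      rw [Real.exp_neg]
      field_simp
  refine hlim.congr' ?_
  filter_upwards [eventually_gt_atTop 0] with n hn
  exact (hlog_eq n hn).symm

end PartitionFunction

section Canonical

variable {V : Type*} [Fintype V] {ζ : ℝ}

/-- The mean of `(1 - ζ) ^ X`, where `X` is the number of triangles of a uniformly random graph on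
`V` with `k` edges. -/
def gnmMean (V : Type*) [Fintype V] (ζ : ℝ) (k : ℕ) : ℝ :=
  (∑ S ∈ Finset.powersetCard k (outerPairs (∅ : Finset V)), (1 - ζ) ^ triIn S) /
    ((Fintype.card V).choose 2).choose k

lemma gnmMean_nonneg (hζ1 : ζ ≤ 1) (k : ℕ) : 0 ≤ gnmMean V ζ k :=
  div_nonneg (Finset.sum_nonneg fun _ _ => pow_nonneg (by linarith) _) (Nat.cast_nonneg _)

lemma choose_mul_gnmMean (ζ : ℝ) (k : ℕ) :
    (((Fintype.card V).choose 2).choose k : ℝ) * gnmMean V ζ k =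
      ∑ S ∈ Finset.powersetCard k (outerPairs (∅ : Finset V)), (1 - ζ) ^ triIn S := by
  unfold gnmMean
  rcases le_or_gt k ((Fintype.card V).choose 2) with h | h
  · have : (((Fintype.card V).choose 2).choose k : ℝ) ≠ 0 := by
      exact_mod_cast (Nat.choose_pos h).ne'
    field_simp
  · rw [Finset.powersetCard_eq_empty.2 (by rwa [card_outerPairs_empty])]
    simp

lemma triZ_eq_sum (ζ lam : ℝ) : triZ V ζ lam =
    ∑ k ∈ Finset.range ((Fintype.card V).choose 2 + 1),
      lam ^ k * (((Fintype.card V).choose 2).choose k * gnmMean V ζ k) := by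
  unfold triZ
  rw [Finset.sum_powerset, card_outerPairs_empty]
  refine Finset.sum_congr rfl fun k _ => ?_
  rw [choose_mul_gnmMean, Finset.mul_sum]
  refine Finset.sum_congr rfl fun S hS => ?_
  rw [(Finset.mem_powersetCard.1 hS).2]

lemma succ_mul_sum_powersetCard_le {α : Type*} [DecidableEq α] (E : Finset α) {w : Finset α → ℝ}
    (hw : ∀ S T, S ⊆ T → w T ≤ w S) (k : ℕ) :
    (k + 1) * ∑ T ∈ Finset.powersetCard (k + 1) E, w T
      ≤ (E.card - k : ℕ) * ∑ S ∈ Finset.powersetCard k E, w S := by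
  calc (k + 1) * ∑ T ∈ Finset.powersetCard (k + 1) E, w T
      = ∑ T ∈ Finset.powersetCard (k + 1) E, ∑ e ∈ T, w T := by
        rw [Finset.mul_sum]
        refine Finset.sum_congr rfl fun T hT => ?_
        rw [Finset.sum_const, (Finset.mem_powersetCard.1 hT).2, nsmul_eq_mul]
        push_cast
        rfl
    _ ≤ ∑ T ∈ Finset.powersetCard (k + 1) E, ∑ e ∈ T, w (T.erase e) :=
        Finset.sum_le_sum fun T _ => Finset.sum_le_sum fun e _ => hw _ _ (Finset.erase_subset _ _)
    _ = ∑ S ∈ Finset.powersetCard k E, ∑ e ∈ E \ S, w S := by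
        rw [Finset.sum_sigma', Finset.sum_sigma']
        refine Finset.sum_bij' (fun x _ => ⟨x.1.erase x.2, x.2⟩)
          (fun x _ => ⟨insert x.2 x.1, x.2⟩) ?_ ?_ ?_ ?_ ?_
        · rintro ⟨T, e⟩ h
          simp only [Finset.mem_sigma, Finset.mem_powersetCard, Finset.mem_sdiff] at h ⊢
          obtain ⟨⟨h1, h2⟩, h3⟩ := h
          refine ⟨⟨(Finset.erase_subset _ _).trans h1, ?_⟩, h1 h3, Finset.notMem_erase _ _⟩
          rw [Finset.card_erase_of_mem h3, h2, Nat.add_sub_cancel]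
        · rintro ⟨S, e⟩ h
          simp only [Finset.mem_sigma, Finset.mem_powersetCard, Finset.mem_sdiff] at h ⊢
          obtain ⟨⟨h1, h2⟩, h3, h4⟩ := h
          refine ⟨⟨Finset.insert_subset h3 h1, ?_⟩, Finset.mem_insert_self _ _⟩
          rw [Finset.card_insert_of_notMem h4, h2]
        · rintro ⟨T, e⟩ h
          simp only [Finset.mem_sigma] at h
          simp only [Finset.insert_erase h.2]
        · rintro ⟨S, e⟩ h
          simp only [Finset.mem_sigma, Finset.mem_sdiff] at h
          simp only [Finset.erase_insert h.2.2]
        · rintro ⟨T, e⟩ _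
          rfl
    _ = (E.card - k : ℕ) * ∑ S ∈ Finset.powersetCard k E, w S := by
        rw [Finset.mul_sum]
        refine Finset.sum_congr rfl fun S hS => ?_
        rw [Finset.mem_powersetCard] at hS
        rw [Finset.sum_const, nsmul_eq_mul, Finset.card_sdiff_of_subset hS.1, hS.2]

lemma gnmMean_antitone (hζ0 : 0 ≤ ζ) (hζ1 : ζ ≤ 1) : Antitone (gnmMean V ζ) := by
  refine antitone_nat_of_succ_le fun k => ?_
  rcases lt_or_ge k ((Fintype.card V).choose 2) with h | h
  · have h1 := succ_mul_sum_powersetCard_le (outerPairs (∅ : Finset V))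
      (w := fun S => (1 - ζ) ^ triIn S)
      (fun S T hST => pow_le_pow_of_le_one (by linarith) (by linarith) (triIn_mono hST)) k
    rw [← choose_mul_gnmMean, ← choose_mul_gnmMean, card_outerPairs_empty] at h1
    have h2 : (((Fintype.card V).choose 2).choose (k + 1) : ℝ) * (k + 1) =
        ((Fintype.card V).choose 2).choose k * (((Fintype.card V).choose 2 - k : ℕ) : ℝ) := by
      exact_mod_cast Nat.choose_succ_right_eq _ k
    have h3 : (0 : ℝ) < ((Fintype.card V).choose 2).choose k *
        (((Fintype.card V).choose 2 - k : ℕ) : ℝ) := by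
      have := Nat.choose_pos h.le
      have h4 : 0 < (Fintype.card V).choose 2 - k := by omega
      positivity
    have h5 : ((k + 1 : ℝ)) * ((((Fintype.card V).choose 2).choose (k + 1) : ℝ) *
        gnmMean V ζ (k + 1)) = (((Fintype.card V).choose 2).choose k *
          (((Fintype.card V).choose 2 - k : ℕ) : ℝ)) * gnmMean V ζ (k + 1) := by
      rw [← h2]; ring
    rw [h5] at h1
    refine le_of_mul_le_mul_left (h1.trans (le_of_eq ?_)) h3
    ring
  · have : gnmMean V ζ (k + 1) = 0 := by
      unfold gnmMean
      rw [Nat.choose_eq_zero_of_lt (by omega : (Fintype.card V).choose 2 < k + 1)]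
      simp
    rw [this]
    exact gnmMean_nonneg hζ1 k

lemma mul_gnmMean_le_triZ {lam : ℝ} (h0 : 0 ≤ lam) (hζ1 : ζ ≤ 1) (m : ℕ) :
    lam ^ m * (((Fintype.card V).choose 2).choose m * gnmMean V ζ m) ≤ triZ V ζ lam := by
  rw [triZ_eq_sum]
  have hnn : ∀ k, 0 ≤ lam ^ k * (((Fintype.card V).choose 2).choose k * gnmMean V ζ k) := fun k =>
    mul_nonneg (pow_nonneg h0 _) (mul_nonneg (Nat.cast_nonneg _) (gnmMean_nonneg hζ1 k))
  rcases le_or_gt m ((Fintype.card V).choose 2) with h | h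
  · exact Finset.single_le_sum (f := fun k => lam ^ k * (((Fintype.card V).choose 2).choose k *
      gnmMean V ζ k)) (fun k _ => hnn k) (Finset.mem_range.2 (by omega))
  · rw [Nat.choose_eq_zero_of_lt h]
    simpa using Finset.sum_nonneg fun k (_ : k ∈ Finset.range _) => hnn k

lemma triZ_le_add {lam lam₀ lam₂ τ : ℝ} (hζ0 : 0 ≤ ζ) (hζ1 : ζ ≤ 1) (h0 : 0 < lam₀)
    (h01 : lam₀ ≤ lam) (h12 : lam ≤ lam₂) (hτ0 : 0 < τ) (hτ : τ ≤ lam) (m M : ℕ) :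
    triZ V ζ lam ≤ (lam / lam₀) ^ m * triZ V ζ lam₀ + (lam / lam₂) ^ M * triZ V ζ lam₂ +
      gnmMean V ζ m * ((lam / τ) ^ M * (1 + τ) ^ ((Fintype.card V).choose 2)) := by
  have hlam : 0 < lam := h0.trans_le h01
  have hlam₂ : 0 < lam₂ := hlam.trans_le h12
  have hbin : (1 + τ) ^ ((Fintype.card V).choose 2) =
      ∑ k ∈ Finset.range ((Fintype.card V).choose 2 + 1),
        τ ^ k * ((Fintype.card V).choose 2).choose k := by
    rw [add_comm, add_pow]
    simp
  rw [triZ_eq_sum, triZ_eq_sum, triZ_eq_sum, hbin, Finset.mul_sum, Finset.mul_sum, Finset.mul_sum,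
    Finset.mul_sum, ← Finset.sum_add_distrib, ← Finset.sum_add_distrib]
  refine Finset.sum_le_sum fun k _ => ?_
  have hpow : ∀ μ : ℝ, 0 < μ → lam ^ k = (lam / μ) ^ k * μ ^ k := fun μ hμ => by
    rw [← mul_pow, div_mul_cancel₀ _ hμ.ne']
  have hak := gnmMean_nonneg (V := V) hζ1 k
  have ham := gnmMean_nonneg (V := V) hζ1 m
  set c : ℝ := (((Fintype.card V).choose 2).choose k : ℝ) with hc
  have hc0 : 0 ≤ c := Nat.cast_nonneg _
  have hA : 0 ≤ (lam / lam₀) ^ m * (lam₀ ^ k * (c * gnmMean V ζ k)) := by positivity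
  have hB : 0 ≤ (lam / lam₂) ^ M * (lam₂ ^ k * (c * gnmMean V ζ k)) := by positivity
  have hC : 0 ≤ gnmMean V ζ m * ((lam / τ) ^ M * (τ ^ k * c)) := by positivity
  rcases lt_or_ge k m with hkm | hkm
  · have : lam ^ k * (c * gnmMean V ζ k) ≤ (lam / lam₀) ^ m * (lam₀ ^ k * (c * gnmMean V ζ k)) := by
      rw [hpow lam₀ h0, mul_assoc]
      gcongr
      rwa [one_le_div h0]
    linarith
  rcases le_or_gt M k with hkM | hkM
  · have : lam ^ k * (c * gnmMean V ζ k) ≤ (lam / lam₂) ^ M * (lam₂ ^ k * (c * gnmMean V ζ k)) := by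
      rw [hpow lam₂ hlam₂, mul_assoc]
      have := pow_le_pow_of_le_one (a := lam / lam₂) (by positivity)
        (div_le_one_of_le₀ h12 hlam₂.le) hkM
      gcongr
    linarith
  · have : lam ^ k * (c * gnmMean V ζ k) ≤ gnmMean V ζ m * ((lam / τ) ^ M * (τ ^ k * c)) := by
      have h1 := gnmMean_antitone (V := V) hζ0 hζ1 hkm
      have h2 : (lam / τ) ^ k ≤ (lam / τ) ^ M := pow_le_pow_right₀ ((one_le_div hτ0).2 hτ) hkM.le
      calc lam ^ k * (c * gnmMean V ζ k) = gnmMean V ζ k * ((lam / τ) ^ k * (τ ^ k * c)) := by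
            rw [hpow τ hτ0]; ring
        _ ≤ _ := by gcongr
    linarith

end Canonical

section CanonicalAsymptotics

lemma eventually_mul_le_of_log {s X A : ℕ → ℝ} {x α c : ℝ} (hc : 0 < c)
    (hs : Tendsto s atTop atTop)
    (hX0 : ∀ᶠ n in atTop, 0 < X n) (hA0 : ∀ᶠ n in atTop, 0 < A n)
    (hX : Tendsto (fun n => Real.log (X n) / s n) atTop (nhds x))
    (hA : Tendsto (fun n => Real.log (A n) / s n) atTop (nhds α)) (h : α < x) :
    ∀ᶠ n in atTop, c * A n ≤ X n := by
  have h1 : Tendsto (fun n => Real.log c / s n + Real.log (A n) / s n) atTop (nhds (0 + α)) :=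
    (tendsto_const_nhds.div_atTop hs).add hA
  rw [zero_add] at h1
  filter_upwards [hX0, hA0, h1.eventually_lt hX h, hs.eventually_gt_atTop 0] with n h2 h3 h4 h5
  rw [← add_div, div_lt_div_iff_of_pos_right h5, ← Real.log_mul hc.ne' h3.ne'] at h4
  exact ((Real.log_lt_log_iff (by positivity) h2).1 h4).le

/-- On the exponential scale `s`, if `X ≤ A + B + C` and `A`, `B` are negligible compared to `X`,
then `C` is at least of the order of `X`. -/
lemma log_ge_of_le_add {s X A B C : ℕ → ℝ} {x α β : ℝ} (hs : Tendsto s atTop atTop)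
    (hX0 : ∀ᶠ n in atTop, 0 < X n) (hA0 : ∀ᶠ n in atTop, 0 < A n) (hB0 : ∀ᶠ n in atTop, 0 < B n)
    (hX : Tendsto (fun n => Real.log (X n) / s n) atTop (nhds x))
    (hA : Tendsto (fun n => Real.log (A n) / s n) atTop (nhds α)) (hα : α < x)
    (hB : Tendsto (fun n => Real.log (B n) / s n) atTop (nhds β)) (hβ : β < x)
    (hle : ∀ᶠ n in atTop, X n ≤ A n + B n + C n) {ε : ℝ} (hε : 0 < ε) :
    ∀ᶠ n in atTop, 0 < C n ∧ x - ε < Real.log (C n) / s n := by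
  have hlog : Tendsto (fun n => Real.log (X n) / s n - Real.log 3 / s n) atTop (nhds (x - 0)) :=
    hX.sub (tendsto_const_nhds.div_atTop hs)
  filter_upwards [hX0, eventually_mul_le_of_log (c := 3) (by norm_num) hs hX0 hA0 hX hA hα,
    eventually_mul_le_of_log (c := 3) (by norm_num) hs hX0 hB0 hX hB hβ, hle,
    hlog.eventually_const_lt (show x - ε < x - 0 by linarith),
    hs.eventually_gt_atTop 0] with n h1 h2 h3 h4 h5 h6
  have hC : X n / 3 ≤ C n := by linarith
  refine ⟨(by positivity : 0 < X n / 3).trans_le hC, h5.trans_le ?_⟩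
  rw [← sub_div, ← Real.log_div h1.ne' (by norm_num)]
  have := Real.log_le_log (by positivity) hC
  gcongr

lemma tendsto_mul_sqrt_atTop : Tendsto (fun n : ℕ => (n : ℝ) * √n) atTop atTop :=
  tendsto_natCast_atTop_atTop.atTop_mul_atTop₀
    (Real.tendsto_sqrt_atTop.comp tendsto_natCast_atTop_atTop)

lemma mul_sqrt_mul_sqrt (n : ℕ) : (n : ℝ) * √n * √n = (n : ℝ) ^ 2 := by
  rw [mul_assoc, Real.mul_self_sqrt (by positivity), sq]

/-- If `m / s` has a positive limit and `s` tends to infinity then so does `m`. -/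
lemma tendsto_atTop_of_div {s : ℕ → ℝ} {m : ℕ → ℕ} {a : ℝ} (ha : 0 < a)
    (hs : Tendsto s atTop atTop) (hm : Tendsto (fun n => (m n : ℝ) / s n) atTop (nhds a)) :
    Tendsto (fun n => (m n : ℝ)) atTop atTop := by
  refine (hm.pos_mul_atTop ha hs).congr' ?_
  filter_upwards [hs.eventually_gt_atTop 0] with n hn
  field_simp

lemma le_log_choose_mul_pow {N m : ℕ} (hm : 0 < m) (hmN : m ≤ N) {lam : ℝ} (hlam : 0 < lam) :
    m * (1 + Real.log ((N + 1 - m) * lam / m)) - Real.log (Stirling.stirlingSeq 1)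
      - 1 / 2 * Real.log (2 * m) ≤ Real.log (N.choose m * lam ^ m) := by
  have h1 : ((N + 1 - m : ℕ) : ℝ) ^ m / (m.factorial : ℝ) ≤ N.choose m :=
    Nat.pow_le_choose m N
  have hN : (((N + 1 - m : ℕ) : ℝ)) = N + 1 - m := by
    rw [Nat.cast_sub (by omega)]; push_cast; ring
  have hNpos : (0 : ℝ) < N + 1 - m := by
    have : (m : ℝ) ≤ N := by exact_mod_cast hmN
    linarith
  rw [hN] at h1
  have hm0 : (0 : ℝ) < m := by exact_mod_cast hm
  have h2 : Real.log (Stirling.stirlingSeq m) ≤ Real.log (Stirling.stirlingSeq 1) := by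
    obtain ⟨k, rfl⟩ := Nat.exists_eq_succ_of_ne_zero hm.ne'
    exact Real.log_le_log (Stirling.stirlingSeq'_pos k)
      (Stirling.stirlingSeq'_antitone (Nat.zero_le k))
  rw [Stirling.log_stirlingSeq_formula] at h2
  have h3 : Real.log ((N + 1 - m) ^ m / m.factorial * lam ^ m)
      ≤ Real.log (N.choose m * lam ^ m) := by
    apply Real.log_le_log
    · have : (0 : ℝ) < m.factorial := by exact_mod_cast m.factorial_pos
      positivity
    · gcongr
  refine le_trans ?_ h3
  have hf : (m.factorial : ℝ) ≠ 0 := by exact_mod_cast m.factorial_ne_zero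
  have e1 : Real.log (((N : ℝ) + 1 - m) ^ m / m.factorial * lam ^ m) =
      m * Real.log ((N : ℝ) + 1 - m) - Real.log m.factorial + m * Real.log lam := by
    rw [Real.log_mul (by positivity) (by positivity), Real.log_div (by positivity) hf, Real.log_pow,
      Real.log_pow]
  have e2 : Real.log (((N : ℝ) + 1 - m) * lam / m) =
      Real.log ((N : ℝ) + 1 - m) + Real.log lam - Real.log m := by
    rw [Real.log_div (by positivity) hm0.ne', Real.log_mul hNpos.ne' hlam.ne']
  rw [e1, e2]
  rw [Real.log_div hm0.ne' (Real.exp_pos 1).ne', Real.log_exp] at h2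
  nlinarith

variable {ζ b : ℝ} {m : ℕ → ℕ}

lemma tendsto_log_div_self_of_atTop {f : ℕ → ℝ} (hf : Tendsto f atTop atTop) :
    Tendsto (fun n => Real.log (f n) / f n) atTop (nhds 0) :=
  (Real.isLittleO_log_id_atTop.tendsto_div_nhds_zero).comp hf

/-- A lower bound for the weight of the `m`-edge graphs at activity `lam`, on a logarithmic
scale. -/
lemma exists_le_log_choose_mul_pow (hb : 0 < b)
    (hm : Tendsto (fun n : ℕ => (m n : ℝ) / (n * √n)) atTop (nhds (b / 2))) :
    ∃ L : ℕ → ℝ, Tendsto L atTop (nhds (b / 2 * (1 + ζ * b ^ 2))) ∧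
      ∀ᶠ n : ℕ in atTop, m n ≤ n.choose 2 ∧
        L n ≤ Real.log ((n.choose 2).choose (m n) * (gibbsAct ζ b / √n) ^ m n) / (n * √n) := by
  have hmtop := tendsto_atTop_of_div (by positivity) tendsto_mul_sqrt_atTop hm
  have hmn : Tendsto (fun n : ℕ => (m n : ℝ) / (n : ℝ) ^ 2) atTop (nhds 0) := by
    have h := hm.mul (tendsto_div_sqrt 1)
    rw [mul_zero] at h
    refine h.congr' ?_
    filter_upwards [eventually_gt_atTop 0] with n hn
    rw [div_mul_div_comm, mul_one, mul_sqrt_mul_sqrt]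
  have hinv : Tendsto (fun n : ℕ => 1 / (n : ℝ) ^ 2) atTop (nhds 0) :=
    tendsto_const_nhds.div_atTop
      ((tendsto_pow_atTop two_ne_zero).comp tendsto_natCast_atTop_atTop)
  have hratio : Tendsto (fun n : ℕ => ((n.choose 2 : ℝ) + 1 - m n) * (gibbsAct ζ b / √n) / m n)
      atTop (nhds (Real.exp (ζ * b ^ 2))) := by
    have h := (((tendsto_choose_two_div.add hinv).sub hmn).mul_const (gibbsAct ζ b)).div hm
      (by positivity)
    have e : (1 / 2 + 0 - 0) * gibbsAct ζ b / (b / 2) = Real.exp (ζ * b ^ 2) := by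
      unfold gibbsAct; field_simp; ring
    rw [e] at h
    refine h.congr' ?_
    filter_upwards [eventually_gt_atTop 0, hmtop.eventually_gt_atTop 0] with n hn hmn0
    have h4 : √(n : ℝ) ≠ 0 := by positivity
    have : (n : ℝ) ≠ 0 := by positivity
    simp only [Pi.div_apply]
    rw [← mul_sqrt_mul_sqrt]
    field_simp
  have hlog : Tendsto (fun n : ℕ => Real.log (2 * m n) / (n * √n)) atTop (nhds 0) := by
    have h := (tendsto_log_div_self_of_atTop (hmtop.const_mul_atTop (zero_lt_two))).mul
      (hm.const_mul 2)
    rw [zero_mul] at h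
    refine h.congr' ?_
    filter_upwards [hmtop.eventually_gt_atTop 0] with n hmn0
    field_simp
  refine ⟨fun n => (m n : ℝ) / (n * √n) *
      (1 + Real.log ((n.choose 2 + 1 - m n) * (gibbsAct ζ b / √n) / m n)) -
      Real.log (Stirling.stirlingSeq 1) / (n * √n) - 1 / 2 * (Real.log (2 * m n) / (n * √n)),
    ?_, ?_⟩
  · have h := ((hm.mul ((hratio.log (Real.exp_pos _).ne').const_add 1)).sub
      (tendsto_const_nhds (x := Real.log (Stirling.stirlingSeq 1)).div_atTop
        tendsto_mul_sqrt_atTop)).sub (hlog.const_mul (1 / 2))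
    rw [Real.log_exp, mul_zero, sub_zero, sub_zero] at h
    exact h
  · have hmle : ∀ᶠ n : ℕ in atTop, (m n : ℝ) / (n : ℝ) ^ 2 < n.choose 2 / (n : ℝ) ^ 2 :=
      hmn.eventually_lt tendsto_choose_two_div (by norm_num)
    filter_upwards [eventually_gt_atTop 0, hmtop.eventually_gt_atTop 0, hmle] with n hn hmn0 h1
    rw [div_lt_div_iff_of_pos_right (by positivity)] at h1
    have hle : m n ≤ n.choose 2 := by exact_mod_cast h1.le
    refine ⟨hle, ?_⟩
    have hact : 0 < gibbsAct ζ b / √(n : ℝ) := by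
      unfold gibbsAct; positivity
    have h2 := le_log_choose_mul_pow (by exact_mod_cast hmn0) hle hact
    have hs : (0 : ℝ) < n * √(n : ℝ) := by positivity
    rw [le_div_iff₀ hs]
    refine le_trans (le_of_eq ?_) h2
    field_simp

/-- The strict inequality that makes graphs with an atypical number of edges negligible. -/
lemma exponent_lt {b₀ b₁ : ℝ} (h0 : 0 < b₀) (h1 : 0 < b₁) (hne : b₀ ≠ b₁) (hζ0 : 0 ≤ ζ) :
    b₀ / 2 * Real.log (gibbsAct ζ b₁ / gibbsAct ζ b₀) + (b₀ / 2 + ζ * b₀ ^ 3 / 3)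
      < b₁ / 2 + ζ * b₁ ^ 3 / 3 := by
  have e : Real.log (gibbsAct ζ b₁ / gibbsAct ζ b₀) =
      Real.log (b₁ / b₀) + ζ * (b₁ ^ 2 - b₀ ^ 2) := by
    unfold gibbsAct
    rw [mul_div_mul_comm, ← Real.exp_sub, Real.log_mul (by positivity) (Real.exp_pos _).ne',
      Real.log_exp]
    ring
  have hlog : Real.log (b₁ / b₀) < b₁ / b₀ - 1 :=
    Real.log_lt_sub_one_of_pos (by positivity) (by
      rw [ne_eq, div_eq_one_iff_eq h0.ne']
      exact hne.symm)
  have h2 : b₀ * Real.log (b₁ / b₀) < b₁ - b₀ := by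
    calc _ < b₀ * (b₁ / b₀ - 1) := by gcongr
      _ = _ := by field_simp
  have h3 : 0 ≤ ζ * ((b₁ - b₀) ^ 2 * (2 * b₁ + b₀)) := by positivity
  rw [e]
  nlinarith

lemma tendsto_log_pow_mul_triZ {b₀ b₁ a : ℝ} {k : ℕ → ℕ} (h0 : 0 < b₀) (h1 : 0 < b₁)
    (hζ0 : 0 ≤ ζ) (hζ1 : ζ ≤ 1) (hw : ζ * b₀ ^ 2 < 1 / 2)
    (hk : Tendsto (fun n : ℕ => (k n : ℝ) / (n * √n)) atTop (nhds a)) :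
    (∀ᶠ n : ℕ in atTop, 0 < (gibbsAct ζ b₁ / √n / (gibbsAct ζ b₀ / √n)) ^ k n *
      triZ (Fin n) ζ (gibbsAct ζ b₀ / √n)) ∧
    Tendsto (fun n : ℕ => Real.log ((gibbsAct ζ b₁ / √n / (gibbsAct ζ b₀ / √n)) ^ k n *
      triZ (Fin n) ζ (gibbsAct ζ b₀ / √n)) / (n * √n)) atTop
      (nhds (a * Real.log (gibbsAct ζ b₁ / gibbsAct ζ b₀) + (b₀ / 2 + ζ * b₀ ^ 3 / 3))) := by
  have hg0 : 0 < gibbsAct ζ b₀ := by unfold gibbsAct; positivity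
  have hg1 : 0 < gibbsAct ζ b₁ := by unfold gibbsAct; positivity
  have hZ : ∀ n : ℕ, 0 < triZ (Fin n) ζ (gibbsAct ζ b₀ / √n) := fun n =>
    zero_lt_one.trans_le (one_le_triZ (by positivity) hζ1)
  constructor
  · filter_upwards [eventually_gt_atTop 0] with n hn
    have := hZ n
    positivity
  · refine ((hk.mul_const _).add (tendsto_log_triZ h0.le hζ0 hζ1 hw)).congr' ?_
    filter_upwards [eventually_gt_atTop 0] with n hn
    have := hZ n
    rw [div_div_div_cancel_right₀ (by positivity), Real.log_mul (by positivity) this.ne',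
      Real.log_pow]
    ring

lemma tendsto_floor_div {a : ℝ} (ha : 0 ≤ a) :
    Tendsto (fun n : ℕ => (⌊a * ((n : ℝ) * √n)⌋₊ : ℝ) / (n * √n)) atTop (nhds a) :=
  (tendsto_nat_floor_mul_div_atTop ha).comp tendsto_mul_sqrt_atTop

lemma gnmMean_upper (hb : 0 < b) (hζ0 : 0 ≤ ζ) (hζ1 : ζ ≤ 1) (hw : ζ * b ^ 2 < 1 / 2)
    (hm : Tendsto (fun n : ℕ => (m n : ℝ) / (n * √n)) atTop (nhds (b / 2)))
    {a : ℝ} (ha : -(ζ * b ^ 3 / 6) < a) :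
    ∀ᶠ n : ℕ in atTop, 0 < gnmMean (Fin n) ζ (m n) →
      Real.log (gnmMean (Fin n) ζ (m n)) / (n * √n) < a := by
  obtain ⟨L, hL, hle⟩ := exists_le_log_choose_mul_pow (ζ := ζ) hb hm
  have h := (tendsto_log_triZ hb.le hζ0 hζ1 hw).sub hL
  rw [show b / 2 + ζ * b ^ 3 / 3 - b / 2 * (1 + ζ * b ^ 2) = -(ζ * b ^ 3 / 6) by ring] at h
  filter_upwards [hle, h.eventually_lt_const ha, eventually_gt_atTop 0] with n h1 h2 hn hpos
  have hg : 0 < gibbsAct ζ b / √(n : ℝ) := by unfold gibbsAct; positivity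
  have hc : (0 : ℝ) < (n.choose 2).choose (m n) := by exact_mod_cast Nat.choose_pos h1.1
  have h3 := mul_gnmMean_le_triZ (V := Fin n) hg.le hζ1 (m n)
  rw [Fintype.card_fin] at h3
  have h4 := Real.log_le_log (by positivity) h3
  rw [show (gibbsAct ζ b / √(n : ℝ)) ^ m n * ((n.choose 2).choose (m n) * gnmMean (Fin n) ζ (m n))
    = ((n.choose 2).choose (m n) * (gibbsAct ζ b / √(n : ℝ)) ^ m n) * gnmMean (Fin n) ζ (m n) by
      ring, Real.log_mul (by positivity) hpos.ne'] at h4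
  have hs : (0 : ℝ) < n * √(n : ℝ) := by positivity
  refine lt_of_le_of_lt ?_ h2
  have h5 := h1.2
  rw [le_div_iff₀ hs] at h5
  rw [le_sub_iff_add_le, ← le_sub_iff_add_le', ← sub_div, le_div_iff₀ hs]
  linarith

lemma gnmMean_lower (hb : 0 < b) (hζ0 : 0 ≤ ζ) (hζ1 : ζ ≤ 1) (hw : ζ * b ^ 2 < 1 / 2)
    (hm : Tendsto (fun n : ℕ => (m n : ℝ) / (n * √n)) atTop (nhds (b / 2)))
    {a : ℝ} (ha : a < -(ζ * b ^ 3 / 6)) :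
    ∀ᶠ n : ℕ in atTop, 0 < gnmMean (Fin n) ζ (m n) ∧
      a < Real.log (gnmMean (Fin n) ζ (m n)) / (n * √n) := by
  obtain ⟨δ, hδ, hδ1, hδ2⟩ : ∃ δ > 0, ζ * (b + 2 * δ) ^ 2 < 1 / 2 ∧
      a < ζ * (b + δ) ^ 3 / 3 - ζ * (b + δ) ^ 2 * (b + 2 * δ) / 2 := by
    have c1 : Tendsto (fun δ : ℝ => ζ * (b + 2 * δ) ^ 2) (nhdsWithin 0 (Set.Ioi 0))
        (nhds (ζ * (b + 2 * 0) ^ 2)) :=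
      (Continuous.tendsto (by fun_prop) 0).mono_left nhdsWithin_le_nhds
    have c2 : Tendsto (fun δ : ℝ => ζ * (b + δ) ^ 3 / 3 - ζ * (b + δ) ^ 2 * (b + 2 * δ) / 2)
        (nhdsWithin 0 (Set.Ioi 0))
        (nhds (ζ * (b + 0) ^ 3 / 3 - ζ * (b + 0) ^ 2 * (b + 2 * 0) / 2)) :=
      (Continuous.tendsto (by fun_prop) 0).mono_left nhdsWithin_le_nhds
    obtain ⟨δ, h1, h2, h3⟩ := ((c1.eventually_lt_const
      (show ζ * (b + 2 * 0) ^ 2 < 1 / 2 by rwa [mul_zero, add_zero])).and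
      ((c2.eventually_const_lt (show a < _ by
        refine ha.trans_le (le_of_eq ?_); ring)).and self_mem_nhdsWithin)).exists
    exact ⟨δ, h3, h1, h2⟩
  set b₁ := b + δ with hb₁
  set b₂ := b + 2 * δ with hb₂
  have hb1 : 0 < b₁ := by positivity
  have hb2 : 0 < b₂ := by positivity
  have hw1 : ζ * b₁ ^ 2 < 1 / 2 := by
    refine lt_of_le_of_lt ?_ hδ1
    have : b₁ ≤ b₂ := by simp only [hb₁, hb₂]; linarith
    gcongr
  have hmono : ∀ x y : ℝ, 0 < x → x ≤ y → gibbsAct ζ x ≤ gibbsAct ζ y := by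
    intro x y hx hxy
    have hy : 0 ≤ y := hx.le.trans hxy
    unfold gibbsAct
    gcongr
  set M : ℕ → ℕ := fun n => ⌊b₂ / 2 * ((n : ℝ) * √n)⌋₊ with hM
  have hMlim : Tendsto (fun n : ℕ => (M n : ℝ) / (n * √n)) atTop (nhds (b₂ / 2)) :=
    tendsto_floor_div (by positivity)
  obtain ⟨hA0, hA⟩ := tendsto_log_pow_mul_triZ hb hb1 hζ0 hζ1 hw hm
  obtain ⟨hB0, hB⟩ := tendsto_log_pow_mul_triZ hb2 hb1 hζ0 hζ1 hδ1 hMlim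
  have hX := tendsto_log_triZ hb1.le hζ0 hζ1 hw1
  have hX0 : ∀ᶠ n : ℕ in atTop, 0 < triZ (Fin n) ζ (gibbsAct ζ b₁ / √n) :=
    Eventually.of_forall fun n => zero_lt_one.trans_le
      (one_le_triZ (div_nonneg (gibbsAct_nonneg hb1.le) (by positivity)) hζ1)
  have hle : ∀ᶠ n : ℕ in atTop, triZ (Fin n) ζ (gibbsAct ζ b₁ / √n) ≤
      (gibbsAct ζ b₁ / √n / (gibbsAct ζ b / √n)) ^ m n * triZ (Fin n) ζ (gibbsAct ζ b / √n) +
      (gibbsAct ζ b₁ / √n / (gibbsAct ζ b₂ / √n)) ^ M n * triZ (Fin n) ζ (gibbsAct ζ b₂ / √n) +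
      gnmMean (Fin n) ζ (m n) * ((gibbsAct ζ b₁ / √n / (b₁ / √n)) ^ M n *
        (1 + b₁ / √n) ^ (n.choose 2)) := by
    filter_upwards [eventually_gt_atTop 0] with n hn
    have hs : 0 < √(n : ℝ) := by positivity
    have hg : 0 < gibbsAct ζ b := by unfold gibbsAct; positivity
    have h := triZ_le_add (V := Fin n) (lam := gibbsAct ζ b₁ / √n) (lam₀ := gibbsAct ζ b / √n)
      (lam₂ := gibbsAct ζ b₂ / √n) (τ := b₁ / √n) hζ0 hζ1 (by positivity)
      (by gcongr; exact hmono _ _ hb (by simp only [hb₁]; linarith))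
      (by gcongr; exact hmono _ _ hb1 (by simp only [hb₁, hb₂]; linarith)) (by positivity)
      (by
        gcongr
        unfold gibbsAct
        exact le_mul_of_one_le_right hb1.le (Real.one_le_exp (by positivity)))
      (m n) (M n)
    rwa [Fintype.card_fin] at h
  set x := b₁ / 2 + ζ * b₁ ^ 3 / 3 with hx
  set g := b₂ / 2 * (ζ * b₁ ^ 2) + 1 / 2 * b₁ with hg
  have hxg : a < x - g := by
    refine hδ2.trans_le (le_of_eq ?_)
    simp only [hx, hg]; ring
  have hC := log_ge_of_le_add tendsto_mul_sqrt_atTop hX0 hA0 hB0 hX hA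
    (exponent_lt hb hb1 (by simp only [hb₁]; linarith) hζ0) hB
    (exponent_lt hb2 hb1 (by simp only [hb₁, hb₂]; intro h; linarith) hζ0) hle
    (ε := (x - g - a) / 2) (by linarith)
  have hG : Tendsto (fun n : ℕ => (M n : ℝ) / (n * √n) * (ζ * b₁ ^ 2) +
      n.choose 2 / (n : ℝ) ^ 2 * b₁) atTop (nhds g) :=
    (hMlim.mul_const _).add (tendsto_choose_two_div.mul_const _)
  filter_upwards [hC, hG.eventually_lt_const (show g < g + (x - g - a) / 2 by linarith),
    eventually_gt_atTop 0] with n h1 h2 hn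
  have hs : (0 : ℝ) < n * √(n : ℝ) := by positivity
  have hsq : 0 < √(n : ℝ) := by positivity
  have hgb : 0 < gibbsAct ζ b₁ := by unfold gibbsAct; positivity
  have hGpos : 0 < (gibbsAct ζ b₁ / √(n : ℝ) / (b₁ / √n)) ^ M n * (1 + b₁ / √n) ^ (n.choose 2) := by
    positivity
  have hpos : 0 < gnmMean (Fin n) ζ (m n) := pos_of_mul_pos_left h1.1 hGpos.le
  refine ⟨hpos, ?_⟩
  have h3 := h1.2
  rw [Real.log_mul hpos.ne' hGpos.ne', Real.log_mul (by positivity) (by positivity), Real.log_pow,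
    Real.log_pow, div_div_div_cancel_right₀ hsq.ne'] at h3
  have h4 : Real.log (gibbsAct ζ b₁ / b₁) = ζ * b₁ ^ 2 := by
    unfold gibbsAct
    rw [mul_div_cancel_left₀ _ hb1.ne', Real.log_exp]
  have h5 : Real.log (1 + b₁ / √(n : ℝ)) ≤ b₁ / √(n : ℝ) := by
    have := Real.log_le_sub_one_of_pos (show 0 < 1 + b₁ / √(n : ℝ) by positivity)
    linarith
  have h6 : (n.choose 2 : ℝ) * Real.log (1 + b₁ / √(n : ℝ)) / (n * √n)
      ≤ n.choose 2 / (n : ℝ) ^ 2 * b₁ := by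
    calc _ ≤ (n.choose 2 : ℝ) * (b₁ / √(n : ℝ)) / (n * √n) := by gcongr
      _ = _ := by rw [← mul_sqrt_mul_sqrt]; field_simp
  rw [h4, add_div, add_div] at h3
  rw [div_mul_eq_mul_div] at h2
  linarith

/-- The asymptotics of the Laplace transform of the number of triangles of `G(n, m)`. -/
lemma tendsto_log_gnmMean (hb : 0 < b) (hζ0 : 0 ≤ ζ) (hζ1 : ζ ≤ 1) (hw : ζ * b ^ 2 < 1 / 2)
    (hm : Tendsto (fun n : ℕ => (m n : ℝ) / (n * √n)) atTop (nhds (b / 2))) :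
    (∀ᶠ n : ℕ in atTop, 0 < gnmMean (Fin n) ζ (m n)) ∧
    Tendsto (fun n : ℕ => Real.log (gnmMean (Fin n) ζ (m n)) / (n * √n)) atTop
      (nhds (-(ζ * b ^ 3 / 6))) := by
  have hpos : ∀ᶠ n : ℕ in atTop, 0 < gnmMean (Fin n) ζ (m n) :=
    (gnmMean_lower hb hζ0 hζ1 hw hm (sub_one_lt _)).mono fun n h => h.1
  refine ⟨hpos, tendsto_order.2 ⟨fun a ha => ?_, fun a ha => ?_⟩⟩
  · exact (gnmMean_lower hb hζ0 hζ1 hw hm ha).mono fun n h => h.2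
  · filter_upwards [gnmMean_upper hb hζ0 hζ1 hw hm ha, hpos] with n h1 h2
    exact h1 h2

end CanonicalAsymptotics

/-- The edges of a graph as a finite set of pairs. -/
def edgePairs {V : Type*} [Fintype V] (G : SimpleGraph V) : Finset (Sym2 V) :=
  Finset.univ.filter (· ∈ G.edgeSet)

section Graphs

variable {V : Type*} [Fintype V]

lemma mem_edgePairs {G : SimpleGraph V} {e : Sym2 V} : e ∈ edgePairs G ↔ e ∈ G.edgeSet := by
  simp [edgePairs]

lemma mem_outerPairs_empty {e : Sym2 V} : e ∈ outerPairs (∅ : Finset V) ↔ ¬ e.IsDiag := by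
  induction e with | _ x y => simp [mem_outerPairs]

lemma sum_edgePairs [Fintype (SimpleGraph V)] (f : Finset (Sym2 V) → ℝ) :
    ∑ G : SimpleGraph V, f (edgePairs G) = ∑ S ∈ (outerPairs (∅ : Finset V)).powerset, f S := by
  refine Finset.sum_bij' (fun G _ => edgePairs G)
    (fun S _ => SimpleGraph.fromEdgeSet (S : Set (Sym2 V))) ?_ ?_ ?_ ?_ ?_
  · intro G _
    rw [Finset.mem_powerset]
    intro e he
    exact mem_outerPairs_empty.2 (G.not_isDiag_of_mem_edgeSet (mem_edgePairs.1 he))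
  · simp
  · intro G _
    ext x y
    rw [SimpleGraph.fromEdgeSet_adj, Finset.mem_coe, mem_edgePairs, SimpleGraph.mem_edgeSet]
    exact ⟨fun h => h.1, fun h => ⟨h, h.ne⟩⟩
  · intro S hS
    ext e
    rw [Finset.mem_powerset] at hS
    rw [mem_edgePairs, SimpleGraph.edgeSet_fromEdgeSet]
    constructor
    · intro h
      exact h.1
    · intro h
      exact ⟨h, mem_outerPairs_empty.1 (hS h)⟩
  · simp

lemma card_isNClique_three (G : SimpleGraph V) :
    Nat.card {s : Finset V // G.IsNClique 3 s} = triIn (edgePairs G) := by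
  refine Nat.subtype_card _ fun T => ?_
  rw [Finset.mem_filter, Finset.mem_powersetCard, SimpleGraph.isNClique_iff, and_comm]
  simp only [mem_edgePairs, SimpleGraph.mem_edgeSet, Finset.subset_univ, true_and]
  rfl

lemma sum_triIn {m : ℕ} (hm3 : 3 ≤ m) :
    ∑ S ∈ Finset.powersetCard m (outerPairs (∅ : Finset V)), triIn S =
      (Fintype.card V).choose 3 * ((Fintype.card V).choose 2 - 3).choose (m - 3) := by
  have hE := card_outerPairs_empty (V := V)
  simp only [triIn, Finset.card_filter]
  rw [Finset.sum_comm]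
  have : ∀ T ∈ Finset.powersetCard 3 (Finset.univ : Finset V),
      ∑ S ∈ Finset.powersetCard m (outerPairs (∅ : Finset V)),
        (if ∀ x ∈ T, ∀ y ∈ T, x ≠ y → s(x, y) ∈ S then 1 else 0) =
      ((Fintype.card V).choose 2 - 3).choose (m - 3) := by
    intro T hT
    rw [Finset.mem_powersetCard] at hT
    obtain ⟨x, y, z, hxy, hxz, hyz, rfl⟩ := Finset.card_eq_three.1 hT.2
    have h3 : ({s(x, y), s(x, z), s(y, z)} : Finset (Sym2 V)).card = 3 := by
      rw [Finset.card_eq_three]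
      refine ⟨_, _, _, ?_, ?_, ?_, rfl⟩ <;> simp <;> grind
    rw [← Finset.card_filter]
    have hsub : ({s(x, y), s(x, z), s(y, z)} : Finset (Sym2 V)) ⊆ outerPairs ∅ := by
      intro e he
      simp only [Finset.mem_insert, Finset.mem_singleton] at he
      rcases he with rfl | rfl | rfl <;> simp [mem_outerPairs, *]
    have h := Finset.card_filter_powersetCard_subset
      {s(x, y), s(x, z), s(y, z)} (outerPairs (∅ : Finset V)) m
    rw [h3, hE] at h
    rw [← h hsub hm3]
    congr 1
    ext S
    simp only [Finset.mem_filter, and_congr_right_iff]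
    intro _
    simp only [Finset.insert_subset_iff, Finset.singleton_subset_iff]
    constructor
    · intro hS
      exact ⟨hS x (by simp) y (by simp) hxy, hS x (by simp) z (by simp) hxz,
        hS y (by simp) z (by simp) hyz⟩
    · rintro ⟨h1, h2, h3⟩ u hu v hv huv
      simp only [Finset.mem_insert, Finset.mem_singleton] at hu hv
      have h1' := Sym2.eq_swap (a := x) (b := y) ▸ h1
      have h2' := Sym2.eq_swap (a := x) (b := z) ▸ h2
      have h3' := Sym2.eq_swap (a := y) (b := z) ▸ h3
      rcases hu with rfl | rfl | rfl <;> rcases hv with rfl | rfl | rfl <;>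
        first | assumption | exact absurd rfl huv
  rw [Finset.sum_congr rfl this, Finset.sum_const, Finset.card_powersetCard,
    Finset.card_univ, smul_eq_mul]

end Graphs

lemma edgeCount_eq_card {n : ℕ} (G : SimpleGraph (Fin n)) : edgeCount G = (edgePairs G).card :=
  Nat.subtype_card _ fun _ => mem_edgePairs

lemma triCount_eq_triIn {n : ℕ} (G : SimpleGraph (Fin n)) : triCount G = triIn (edgePairs G) :=
  card_isNClique_three G

lemma sum_edgeCount_eq {n m : ℕ} (f : Finset (Sym2 (Fin n)) → ℝ) :
    ∑ G : SimpleGraph (Fin n), (if edgeCount G = m then f (edgePairs G) else 0) =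
      ∑ S ∈ Finset.powersetCard m (outerPairs (∅ : Finset (Fin n))), f S := by
  simp only [edgeCount_eq_card]
  rw [sum_edgePairs fun S => if S.card = m then f S else 0, ← Finset.sum_filter,
    Finset.powersetCard_eq_filter]

lemma gnmProb_eq (n m : ℕ) (c : ℝ) :
    gnmProb n m {G | (triCount G : ℝ) ≤ c} =
      (∑ S ∈ Finset.powersetCard m (outerPairs (∅ : Finset (Fin n))),
        if (triIn S : ℝ) ≤ c then (1 : ℝ) else 0) / (n.choose 2).choose m := by
  rw [gnmProb, ← sum_edgeCount_eq]
  congr 1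
  rw [Nat.subtype_card (Finset.univ.filter fun G : SimpleGraph (Fin n) =>
    edgeCount G = m ∧ (triCount G : ℝ) ≤ c) (by simp), Finset.card_filter]
  push_cast
  refine Finset.sum_congr rfl fun G _ => ?_
  rw [triCount_eq_triIn, ite_and]

lemma gnmExpTri_eq_sum (n m : ℕ) :
    gnmExpTri n m = (∑ S ∈ Finset.powersetCard m (outerPairs (∅ : Finset (Fin n))),
        (triIn S : ℝ)) / (n.choose 2).choose m := by
  rw [gnmExpTri, ← sum_edgeCount_eq]
  simp only [triCount_eq_triIn]

lemma gnmExpTri_eq {n m : ℕ} (hm3 : 3 ≤ m) (hmn : m ≤ n.choose 2) :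
    gnmExpTri n m = (n.choose 3 * m.choose 3 : ℝ) / (n.choose 2).choose 3 := by
  have key := sum_triIn (V := Fin n) hm3
  rw [Fintype.card_fin] at key
  have hchoose := Nat.choose_mul (n := n.choose 2) (k := m) (s := 3) hm3
  rw [gnmExpTri_eq_sum, ← Nat.cast_sum, key]
  have h1 : ((n.choose 2).choose m : ℝ) ≠ 0 := by exact_mod_cast (Nat.choose_pos hmn).ne'
  have h2 : ((n.choose 2).choose 3 : ℝ) ≠ 0 := by
    exact_mod_cast (Nat.choose_pos (hm3.trans hmn)).ne'
  rw [div_eq_div_iff h1 h2]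
  push_cast
  have hc : ((n.choose 2).choose m : ℝ) * m.choose 3 =
    (n.choose 2).choose 3 * (n.choose 2 - 3).choose (m - 3) := by exact_mod_cast hchoose
  linear_combination (-(n.choose 3 : ℝ)) * hc

lemma tendsto_choose_three_div {u : ℕ → ℕ} (hu : Tendsto u atTop atTop) :
    Tendsto (fun n => ((u n).choose 3 : ℝ) / (u n : ℝ) ^ 3) atTop (nhds (1 / 6)) := by
  have h := (isEquivalent_choose 3).comp_tendsto hu
  have hne : ∀ᶠ n in atTop, (u n : ℝ) ^ 3 ≠ 0 := by
    filter_upwards [hu.eventually_gt_atTop 0] with n hn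
    positivity
  have h6 := (Asymptotics.isEquivalent_iff_tendsto_one (by
    filter_upwards [hne] with n hn
    simpa [Nat.factorial] using hn)).1 h
  have := h6.mul_const (1 / 6 : ℝ)
  rw [one_mul] at this
  refine this.congr' ?_
  filter_upwards [hne] with n hn
  simp [Nat.factorial]
  field_simp

lemma tendsto_gnmExpTri_div {b : ℝ} (hb : 0 < b) {m : ℕ → ℕ}
    (hm : Tendsto (fun n : ℕ => (m n : ℝ) / (n * √n)) atTop (nhds (b / 2))) :
    Tendsto (fun n : ℕ => gnmExpTri n (m n) / (n * √n)) atTop (nhds (b ^ 3 / 6)) := by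
  have hmtop : Tendsto m atTop atTop :=
    tendsto_natCast_atTop_iff.1
      (tendsto_atTop_of_div (by positivity) tendsto_mul_sqrt_atTop hm)
  have hNtop : Tendsto (fun n : ℕ => n.choose 2) atTop atTop := by
    refine tendsto_atTop_mono' atTop ?_ (tendsto_sub_atTop_nat 1)
    filter_upwards [eventually_ge_atTop 2] with n hn
    rw [Nat.choose_two_right, Nat.le_div_iff_mul_le two_pos, mul_comm]
    exact Nat.mul_le_mul_right _ hn
  have hmn : ∀ᶠ n : ℕ in atTop, m n ≤ n.choose 2 := by
    have h1 : Tendsto (fun n : ℕ => (m n : ℝ) / (n : ℝ) ^ 2) atTop (nhds 0) := by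
      have h := hm.mul (tendsto_div_sqrt 1)
      rw [mul_zero] at h
      refine h.congr' ?_
      filter_upwards [eventually_gt_atTop 0] with n hn
      have hn' : (0 : ℝ) < n := by exact_mod_cast hn
      rw [← mul_sqrt_mul_sqrt n]
      field_simp
    filter_upwards [h1.eventually_lt tendsto_choose_two_div (by norm_num),
      eventually_gt_atTop 0] with n h hn
    have hn' : (0 : ℝ) < (n : ℝ) ^ 2 := by positivity
    exact_mod_cast ((div_lt_div_iff_of_pos_right hn').1 h).le
  have h := ((tendsto_choose_three_div tendsto_id).mul
    ((tendsto_choose_three_div hmtop).mul (hm.pow 3))).div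
    ((tendsto_choose_three_div hNtop).mul (tendsto_choose_two_div.pow 3)) (by norm_num)
  have e : 1 / 6 * (1 / 6 * (b / 2) ^ 3) / (1 / 6 * (1 / 2 : ℝ) ^ 3) = b ^ 3 / 6 := by ring
  rw [e] at h
  refine h.congr' ?_
  filter_upwards [hmn, hmtop.eventually_ge_atTop 3, hNtop.eventually_gt_atTop 0,
    eventually_gt_atTop 0] with n h1 h2 h3 h4
  rw [gnmExpTri_eq h2 h1]
  have hn' : (0 : ℝ) < n := by exact_mod_cast h4
  have hm' : (0 : ℝ) < m n := by exact_mod_cast (by omega : 0 < m n)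
  have hN' : (0 : ℝ) < n.choose 2 := by exact_mod_cast h3
  have hC : (0 : ℝ) < (n.choose 2).choose 3 := by
    exact_mod_cast Nat.choose_pos (h2.trans h1)
  simp only [id, Pi.div_apply]
  set r := √(n : ℝ) with hr
  have hr0 : 0 < r := Real.sqrt_pos.2 hn'
  have hnr : (n : ℝ) = r ^ 2 := (Real.sq_sqrt hn'.le).symm
  rw [hnr]
  field_simp

/-- The proportion of the `k`-edge graphs on `V` with at most `c` triangles. -/
def lowerTail (V : Type*) [Fintype V] (k : ℕ) (c : ℝ) : ℝ :=
  (∑ S ∈ Finset.powersetCard k (outerPairs (∅ : Finset V)),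
    if (triIn S : ℝ) ≤ c then (1 : ℝ) else 0) / ((Fintype.card V).choose 2).choose k

section LowerTail

variable {V : Type*} [Fintype V] {b : ℝ} {m : ℕ → ℕ}

lemma gnmProb_eq_lowerTail (n m : ℕ) (c : ℝ) :
    gnmProb n m {G | (triCount G : ℝ) ≤ c} = lowerTail (Fin n) m c := by
  rw [gnmProb_eq, lowerTail, Fintype.card_fin]

lemma lowerTail_zero (k : ℕ) : lowerTail V k 0 = gnmMean V 1 k := by
  rw [lowerTail, gnmMean]
  congr 1
  refine Finset.sum_congr rfl fun S _ => ?_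
  rcases Nat.eq_zero_or_pos (triIn S) with h | h
  · simp [h]
  · have : ¬ ((triIn S : ℝ) ≤ 0) := by
      rw [not_le]
      exact_mod_cast h
    simp [this, h.ne']

lemma lowerTail_mul_rpow_le {η : ℝ} (h0 : 0 < η) (h1 : η ≤ 1) (k : ℕ) (c : ℝ) :
    lowerTail V k c * η ^ c ≤ gnmMean V (1 - η) k := by
  rw [lowerTail, gnmMean, div_mul_eq_mul_div, Finset.sum_mul]
  refine div_le_div_of_nonneg_right (Finset.sum_le_sum fun S _ => ?_) (Nat.cast_nonneg _)
  rw [sub_sub_cancel]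
  split_ifs with h
  · rw [one_mul, ← Real.rpow_natCast]
    exact Real.rpow_le_rpow_of_exponent_ge h0 h1 h
  · rw [zero_mul]
    positivity

lemma pow_le_tilted_add {q₀ q₁ η r c : ℝ} (h0 : 0 < q₀) (h01 : q₀ ≤ q₁) (h1η : q₁ ≤ η)
    (hη : η ≤ 1) (x : ℕ) :
    q₁ ^ x ≤ (q₁ / q₀) ^ r * q₀ ^ x + (q₁ / η) ^ c * η ^ x +
      q₁ ^ r * (if (x : ℝ) ≤ c then 1 else 0) := by
  have hq1 : 0 < q₁ := h0.trans_le h01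
  have hη0 : 0 < η := hq1.trans_le h1η
  have e0 : q₁ ^ x = (q₁ / q₀) ^ (x : ℝ) * q₀ ^ x := by
    rw [Real.rpow_natCast, ← mul_pow, div_mul_cancel₀ _ h0.ne']
  have e1 : q₁ ^ x = (q₁ / η) ^ (x : ℝ) * η ^ x := by
    rw [Real.rpow_natCast, ← mul_pow, div_mul_cancel₀ _ hη0.ne']
  have p0 : 0 ≤ (q₁ / q₀) ^ r * q₀ ^ x := by positivity
  have p1 : 0 ≤ (q₁ / η) ^ c * η ^ x := by positivity
  have p2 : 0 ≤ q₁ ^ r * (if (x : ℝ) ≤ c then (1 : ℝ) else 0) := by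
    split_ifs <;> positivity
  rcases le_or_gt (x : ℝ) r with hr | hr
  · have h : (q₁ / q₀) ^ (x : ℝ) * q₀ ^ x ≤ (q₁ / q₀) ^ r * q₀ ^ x :=
      mul_le_mul_of_nonneg_right
        (Real.rpow_le_rpow_of_exponent_le ((one_le_div h0).2 h01) hr) (by positivity)
    linarith
  rcases le_or_gt (x : ℝ) c with hc | hc
  · have h : q₁ ^ (x : ℝ) ≤ q₁ ^ r :=
      Real.rpow_le_rpow_of_exponent_ge hq1 (h1η.trans hη) hr.le
    rw [Real.rpow_natCast] at h
    rw [if_pos hc] at p2 ⊢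
    linarith
  · have h : (q₁ / η) ^ (x : ℝ) * η ^ x ≤ (q₁ / η) ^ c * η ^ x :=
      mul_le_mul_of_nonneg_right (Real.rpow_le_rpow_of_exponent_ge (by positivity)
        ((div_le_one hη0).2 h1η) hc.le) (by positivity)
    linarith

lemma gnmMean_le_tilted_add {q₀ q₁ η : ℝ} (r c : ℝ) (h0 : 0 < q₀) (h01 : q₀ ≤ q₁)
    (h1η : q₁ ≤ η) (hη : η ≤ 1) (k : ℕ) :
    gnmMean V (1 - q₁) k ≤ (q₁ / q₀) ^ r * gnmMean V (1 - q₀) k +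
      (q₁ / η) ^ c * gnmMean V (1 - η) k + q₁ ^ r * lowerTail V k c := by
  simp only [gnmMean, lowerTail, sub_sub_cancel]
  rw [← mul_div_assoc, ← mul_div_assoc, ← mul_div_assoc, ← add_div, ← add_div, Finset.mul_sum,
    Finset.mul_sum, Finset.mul_sum, ← Finset.sum_add_distrib, ← Finset.sum_add_distrib]
  exact div_le_div_of_nonneg_right
    (Finset.sum_le_sum fun S _ => pow_le_tilted_add h0 h01 h1η hη _) (Nat.cast_nonneg _)

lemma tendsto_log_rpow_mul {s u M : ℕ → ℝ} {q v x : ℝ} (hq : 0 < q)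
    (hu : Tendsto (fun n => u n / s n) atTop (nhds v)) (hM0 : ∀ᶠ n in atTop, 0 < M n)
    (hM : Tendsto (fun n => Real.log (M n) / s n) atTop (nhds x)) :
    Tendsto (fun n => Real.log (q ^ u n * M n) / s n) atTop (nhds (v * Real.log q + x)) := by
  refine ((hu.mul_const (Real.log q)).add hM).congr' ?_
  filter_upwards [hM0] with n hn
  rw [Real.log_mul (Real.rpow_pos_of_pos hq _).ne' hn.ne', Real.log_rpow hq]
  ring

lemma mul_log_div_lt {x y : ℝ} (hx : 0 < x) (hy : 0 < y) (hxy : x ≠ y) :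
    y * Real.log (x / y) < x - y := by
  have h := Real.log_lt_sub_one_of_pos (div_pos hx hy) (by rwa [Ne, div_eq_one_iff_eq hy.ne'])
  calc y * Real.log (x / y) < y * (x / y - 1) := mul_lt_mul_of_pos_left h hy
    _ = x - y := by field_simp

lemma lowerTail_lower_aux {q₀ q₁ η : ℝ} (hb : 0 < b) (h0 : 0 < q₀) (h01 : q₀ < q₁)
    (h1η : q₁ < η) (hη : η < 1) (hw : (1 - q₀) * b ^ 2 < 1 / 2)
    (hm : Tendsto (fun n : ℕ => (m n : ℝ) / (n * √n)) atTop (nhds (b / 2)))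
    {ε : ℝ} (hε : 0 < ε) :
    ∀ᶠ n : ℕ in atTop, 0 < lowerTail (Fin n) (m n) (η * gnmExpTri n (m n)) ∧
      -((1 - q₁) * b ^ 3 / 6) - q₀ * (b ^ 3 / 6) * Real.log q₁ - ε <
        Real.log (lowerTail (Fin n) (m n) (η * gnmExpTri n (m n))) / (n * √n) := by
  have hq1 : 0 < q₁ := h0.trans h01
  have hη0 : 0 < η := hq1.trans h1η
  have hmu : 0 < b ^ 3 / 6 := by positivity
  have hb2 : 0 < b ^ 2 := by positivity
  obtain ⟨p0, t0⟩ := tendsto_log_gnmMean (ζ := 1 - q₀) hb (by linarith) (by linarith) hw hm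
  obtain ⟨p1, t1⟩ := tendsto_log_gnmMean (ζ := 1 - q₁) hb (by linarith) (by linarith)
    (by nlinarith) hm
  obtain ⟨p2, t2⟩ := tendsto_log_gnmMean (ζ := 1 - η) hb (by linarith) (by linarith)
    (by nlinarith) hm
  have hr : Tendsto (fun n : ℕ => (q₀ * (b ^ 3 / 6) * (n * √n)) / (n * √n)) atTop
      (nhds (q₀ * (b ^ 3 / 6))) := by
    refine tendsto_const_nhds.congr' ?_
    filter_upwards [tendsto_mul_sqrt_atTop.eventually_gt_atTop 0] with n hn
    rw [mul_div_assoc, div_self hn.ne', mul_one]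
  have hc : Tendsto (fun n : ℕ => (η * gnmExpTri n (m n)) / (n * √n)) atTop
      (nhds (η * (b ^ 3 / 6))) := by
    simpa only [mul_div_assoc] using (tendsto_gnmExpTri_div hb hm).const_mul η
  have hA := tendsto_log_rpow_mul (div_pos hq1 h0) hr p0 t0
  have hB := tendsto_log_rpow_mul (div_pos hq1 hη0) hc p2 t2
  have key := log_ge_of_le_add (C := fun n : ℕ => q₁ ^ (q₀ * (b ^ 3 / 6) * (n * √n)) *
      lowerTail (Fin n) (m n) (η * gnmExpTri n (m n))) tendsto_mul_sqrt_atTop p1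
    (p0.mono fun n hn => mul_pos (Real.rpow_pos_of_pos (div_pos hq1 h0) _) hn)
    (p2.mono fun n hn => mul_pos (Real.rpow_pos_of_pos (div_pos hq1 hη0) _) hn) t1 hA
    (by nlinarith [mul_log_div_lt hq1 h0 h01.ne']) hB
    (by nlinarith [mul_log_div_lt hq1 hη0 h1η.ne])
    (Eventually.of_forall fun n => gnmMean_le_tilted_add _ _ h0 h01.le h1η.le hη.le _) hε
  filter_upwards [key, tendsto_mul_sqrt_atTop.eventually_gt_atTop 0] with n ⟨h1, h2⟩ hn
  have hpow : 0 < q₁ ^ (q₀ * (b ^ 3 / 6) * (n * √n)) := Real.rpow_pos_of_pos hq1 _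
  have hP : 0 < lowerTail (Fin n) (m n) (η * gnmExpTri n (m n)) :=
    (pos_iff_pos_of_mul_pos h1).1 hpow
  refine ⟨hP, ?_⟩
  rw [Real.log_mul hpow.ne' hP.ne', Real.log_rpow hq1, add_div, mul_right_comm,
    mul_div_cancel_right₀ _ hn.ne'] at h2
  linarith

lemma tendsto_log_lowerTail {η : ℝ} (hb : 0 < b) (hη0 : 0 ≤ η) (hη1 : η < 1)
    (hw : (1 - η) * b ^ 2 < 1 / 2)
    (hm : Tendsto (fun n : ℕ => (m n : ℝ) / (n * √n)) atTop (nhds (b / 2))) :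
    Tendsto (fun n : ℕ =>
        Real.log (lowerTail (Fin n) (m n) (η * gnmExpTri n (m n))) / (n * √n))
      atTop (nhds (-(b ^ 3 / 6) * (1 - η + η * Real.log η))) := by
  rcases hη0.eq_or_lt with rfl | hη
  · have h := (tendsto_log_gnmMean (ζ := 1) hb zero_le_one le_rfl (by simpa using hw) hm).2
    simp only [zero_mul, lowerTail_zero]
    convert h using 2
    ring
  have lower : ∀ a, a < -(b ^ 3 / 6) * (1 - η + η * Real.log η) → ∀ᶠ n : ℕ in atTop,
      0 < lowerTail (Fin n) (m n) (η * gnmExpTri n (m n)) ∧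
      a < Real.log (lowerTail (Fin n) (m n) (η * gnmExpTri n (m n))) / (n * √n) := by
    intro a ha
    have hf : ContinuousAt (fun δ : ℝ => -((1 - (η - δ)) * b ^ 3 / 6) -
        (η - 2 * δ) * (b ^ 3 / 6) * Real.log (η - δ) - δ) 0 := by
      have : η - (0 : ℝ) ≠ 0 := by simpa using hη.ne'
      fun_prop (disch := assumption)
    have hg : ContinuousAt (fun δ : ℝ => (1 - (η - 2 * δ)) * b ^ 2) 0 := by fun_prop
    have hh : ContinuousAt (fun δ : ℝ => η - 2 * δ) 0 := by fun_prop
    have e1 := continuousAt_const.eventually_lt hf (show a < _ by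
      convert ha using 1
      simp only [sub_zero, mul_zero]
      ring)
    have e2 := hg.eventually_lt continuousAt_const (show _ < (1 / 2 : ℝ) by simpa using hw)
    have e3 := continuousAt_const.eventually_lt hh (show (0 : ℝ) < _ by simpa using hη)
    obtain ⟨δ, ⟨⟨h1, h2⟩, h3⟩, hδ⟩ := ((((e1.and e2).and e3).filter_mono
      nhdsWithin_le_nhds).and (self_mem_nhdsWithin (s := Set.Ioi (0 : ℝ)))).exists
    have hδ' : (0 : ℝ) < δ := hδ
    filter_upwards [lowerTail_lower_aux (q₀ := η - 2 * δ) (q₁ := η - δ) hb h3 (by linarith)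
      (by linarith) hη1 h2 hm hδ'] with n hn
    exact ⟨hn.1, h1.trans hn.2⟩
  refine tendsto_order.2 ⟨fun a ha => (lower a ha).mono fun n hn => hn.2, fun a ha => ?_⟩
  obtain ⟨p, t⟩ := tendsto_log_gnmMean (ζ := 1 - η) hb (by linarith) (by linarith) hw hm
  have hc : Tendsto (fun n : ℕ => (η * gnmExpTri n (m n)) / (n * √n)) atTop
      (nhds (η * (b ^ 3 / 6))) := by
    simpa only [mul_div_assoc] using (tendsto_gnmExpTri_div hb hm).const_mul η
  have hlim := t.sub (hc.mul_const (Real.log η))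
  have hlt : -((1 - η) * b ^ 3 / 6) - η * (b ^ 3 / 6) * Real.log η < a := by linarith
  filter_upwards [hlim.eventually_lt_const hlt, lower _ (sub_one_lt _),
    tendsto_mul_sqrt_atTop.eventually_gt_atTop 0] with n h1 h2 hn
  refine lt_of_le_of_lt ?_ h1
  have h := Real.log_le_log (mul_pos h2.1 (Real.rpow_pos_of_pos hη _))
    (lowerTail_mul_rpow_le (V := Fin n) hη hη1.le (m n) (η * gnmExpTri n (m n)))
  rw [Real.log_mul h2.1.ne' (Real.rpow_pos_of_pos hη _).ne', Real.log_rpow hη] at h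
  rw [div_mul_eq_mul_div, ← sub_div]
  exact div_le_div_of_nonneg_right (by linarith) hn.le

end LowerTail

lemma IsLambertW.apply_two_div_exp_lt {W : ℝ → ℝ} (hW : IsLambertW W) :
    W (2 / Real.exp 1) < 1 / 2 := by
  obtain ⟨-, h, -⟩ := hW (2 / Real.exp 1) (by positivity)
  by_contra! hle
  have h1 : (1 / 2 : ℝ) * Real.exp (1 / 2) ≤ 2 / Real.exp 1 := by
    rw [← h]
    gcongr
  rw [le_div_iff₀ (Real.exp_pos 1), mul_assoc, ← Real.exp_add] at h1
  have h2 := Real.quadratic_le_exp_of_nonneg (show (0 : ℝ) ≤ 1 / 2 + 1 by norm_num)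
  have h3 : Real.exp (1 / 2 + 1) ^ 2 = Real.exp 1 ^ 3 := by
    rw [← Real.exp_nat_mul, ← Real.exp_nat_mul]
    norm_num
  have h4 := Real.exp_one_gt_d9
  have h5 : (2.7 : ℝ) ^ 3 ≤ Real.exp 1 ^ 3 := by gcongr; linarith
  nlinarith [Real.exp_pos (1 / 2 + 1 : ℝ)]

lemma rpow_three_halves (n : ℕ) : (n : ℝ) ^ ((3 : ℝ) / 2) = n * √n := by
  rw [show (3 : ℝ) / 2 = 1 + 1 / 2 by norm_num, Real.rpow_add_of_nonneg (Nat.cast_nonneg n)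
    zero_le_one (by norm_num), Real.rpow_one, Real.sqrt_eq_rpow]

/-- **Theorem (lower tails for triangles in `G(n,m)`).** -/
theorem lower_tail_gnm
    (W : ℝ → ℝ) (hW : IsLambertW W)
    (b η : ℝ) (hb : 0 < b) (hη : η ∈ Set.Ico (0 : ℝ) 1)
    (hbW : b ^ 2 * (1 - η) < W (2 / Real.exp 1))
    (m : ℕ → ℕ)
    (hm : Tendsto (fun n : ℕ => (m n : ℝ) / (n : ℝ) ^ ((3 : ℝ) / 2)) atTop (nhds (b / 2))) :
    Tendsto (fun n : ℕ =>
        Real.log (gnmProb n (m n) {G | (triCount G : ℝ) ≤ η * gnmExpTri n (m n)}) /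
          (n : ℝ) ^ ((3 : ℝ) / 2))
      atTop (nhds (-(b ^ 3 / 6) * (1 - η + η * Real.log η))) := by
  simp only [rpow_three_halves, gnmProb_eq_lowerTail] at hm ⊢
  exact tendsto_log_lowerTail hb hη.1 hη.2
    (by linarith [hW.apply_two_div_exp_lt]) hm
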